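/- arXiv:2305.11677 — 4 statements merged into one kernel-verified Lean document; each statement's English description precedes it below -/
import Mathlib

section
/- Let q be an odd prime power, λ an integer with 2 ≤ λ < q+1 and λ ∣ (q+1), m = 2t+1 ≥ 5 with t even, and n = (q^m+1)/λ. Let δ be an integer with 1 ≤ δ-1 ≤ (2q^{t+1}+2q-1)/λ, set ε = ⌈(δ-1)(1-q^{-1})⌉ and υ = ⌊(q-2)/λ⌋ + ⌊q/λ⌋. Then the union C_1 ∪ ... ∪ C_{δ-1} of q-cyclotomic cosets modulo n has cardinality n - k (equivalently, the BCH code C_{(n,q,δ,1)} has dimension k and C_{(n,q,δ+1,0)} has dimension k-1), where k is as follows. (1) k = n - 2mε if 2 ≤ δ ≤ (q^{t+1}+1)/λ - ⌊q/λ⌋; k = n - 2mε + 2m(δ - (q^{t+1}+1)/λ + ⌊q/λ⌋) if (q^{t+1}+1)/λ - ⌊q/λ⌋ < δ ≤ (q^{t+1}+1)/λ + ⌊(q-2)/λ⌋; k = n - 2m(ε - υ - 1) if (q^{t+1}+1)/λ + ⌊(q-2)/λ⌋ < δ ≤ (q^{t+1}+1)/λ + 2(q^t-1)/λ. (2) If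 ⌊(q-3)/λ⌋ ≠ 0 and a is an integer with 0 ≤ a ≤ ⌊(q-3)/λ⌋ - 1, then k = n - 2m(ε - υ - 2a - 2) if (q^{t+1}+1)/λ + 2(q^t-1)/λ + a·q^t < δ ≤ (q^{t+1}+1)/λ + (a+1)q^t, and k = n - 2m(ε - υ - 2a - 3) if (q^{t+1}+1)/λ + (a+1)q^t < δ ≤ (q^{t+1}+1)/λ + 2(q^t-1)/λ + (a+1)q^t. (3) Set κ = 2(q^{t+1}+1)/λ - ⌊(2q+1)/λ⌋ and τ = ⌈(κ-1)(1-q^{-1})⌉. (i) If ⌊(q-1)/λ⌋ = ⌊(q-3)/λ⌋: k = n - 2m(ε - υ - 2⌊(q-1)/λ⌋ - 2) if (q^{t+1}+1)/λ + 2(q^t-1)/λ + ⌊(q-3)/λ⌋q^t < δ ≤ κ, and k = n - 2m(τ - υ - 2⌊(q-1)/λ⌋ - 2) if κ < δ ≤ (2q^{t+1}+2q-1)/λ + 1. (ii) If ⌊(q-1)/λ⌋ = ⌊(q-3)/λ⌋ + 1: k = n - 2m(ε - υ - 2⌊(q-1)/λ⌋) if (q^{t+1}+1)/λ + 2(q^t-1)/λ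 + ⌊(q-3)/λ⌋q^t < δ ≤ (q^{t+1}+1)/λ + ⌊(q-1)/λ⌋q^t; k = n - 2m(ε - υ - 2⌊(q-1)/λ⌋ - 1) if (q^{t+1}+1)/λ + ⌊(q-1)/λ⌋q^t < δ ≤ κ; and k = n - 2m(τ - υ - 2⌊(q-1)/λ⌋ - 1) if κ < δ ≤ (2q^{t+1}+2q-1)/λ + 1. -/
/-- The `q`-cyclotomic coset of `s` modulo `n`:
`C_s = { s·q^j mod n : 0 ≤ j ≤ ord_n(q) - 1 }`. -/
noncomputable def cycCoset (q n s : ℕ) : Finset ℕ :=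
  (Finset.range (orderOf (q : ZMod n))).image fun j => s * q ^ j % n

/-- `s` is a coset leader modulo `n` iff `s = min C_s`. -/
def IsCosetLeader (q n s : ℕ) : Prop :=
  s ∈ cycCoset q n s ∧ ∀ x ∈ cycCoset q n s, s ≤ x

/-- The set of coset leaders modulo `n` (as a finset of `{0, …, n-1}`). -/
noncomputable def cosetLeaders (q n : ℕ) : Finset ℕ :=
  (Finset.range n).filter fun s => s ∈ cycCoset q n s ∧ ∀ x ∈ cycCoset q n s, s ≤ x

/-- The `i`-th largest coset leader modulo `n` (for `i ≥ 1`), i.e. `δ_{i,n}`. -/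
noncomputable def nthLargestCosetLeader (q n i : ℕ) : ℕ :=
  (((cosetLeaders q n).sort (· ≤ ·)).reverse).getD (i - 1) 0


set_option maxHeartbeats 1000000 in
/-- The basic congruence analysis modulo `q^(2t+1)+1`. -/
lemma key_cong (q Q x y σ : ℤ) (t j : ℕ) (hq : 3 ≤ q) (hQ : Q = q ^ t) (hQ2 : q * q ≤ Q)
    (hj : j ≤ t) (hx1 : 1 ≤ x) (hy1 : 1 ≤ y) (hx : x ≤ 2 * q * Q + 2 * q - 1)
    (hy : y ≤ 2 * q * Q + 2 * q - 1) (hσ : σ = 1 ∨ σ = -1)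
    (hdvd : q * Q ^ 2 + 1 ∣ q ^ j * x - σ * y) :
    (σ = 1 ∧ y = q ^ j * x) ∨
    (∃ u, -(2 * q) ≤ u ∧ u ≤ 2 * q ∧ x = q * Q + u ∧ σ * y = u * Q - 1) ∨
    (∃ u, -(2 * q) ≤ u ∧ u ≤ 2 * q - 1 ∧ x = 2 * q * Q + u ∧ σ * y = u * Q - 2) := by
  obtain ⟨c, hc⟩ := hdvd
  have hQ3 : 3 * q ≤ Q := by nlinarith
  have hqQ : 9 * Q ≤ q * Q * 3 := by nlinarith
  have hQQ : 9 * (q * Q) ≤ q * Q ^ 2 := by nlinarith [mul_nonneg (by linarith : (0:ℤ) ≤ q) (by linarith : (0:ℤ) ≤ Q)]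
  have hp1 : 1 ≤ q ^ j := one_le_pow₀ (by linarith)
  have hpQ : q ^ j ≤ Q := by rw [hQ]; exact pow_le_pow_right₀ (by linarith) hj
  have hys : |σ * y| = y := by
    rcases hσ with h | h <;> subst h <;> simp <;> linarith
  have hy2 : σ * y ≤ y := by rw [← hys]; simpa [hys] using le_abs_self (σ * y)
  have hy3 : -y ≤ σ * y := by rw [← hys]; simpa [hys] using neg_abs_le (σ * y)
  have hpx1 : 1 ≤ q ^ j * x := by nlinarith
  have hpx : q ^ j * x ≤ Q * (2 * q * Q + 2 * q - 1) :=
    mul_le_mul hpQ hx (by linarith) (by linarith)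
  have hc0 : 0 ≤ c := by
    by_contra h
    have : c ≤ -1 := by omega
    nlinarith [sq_nonneg Q]
  have hc2 : c ≤ 2 := by
    by_contra h
    have : 3 ≤ c := by omega
    nlinarith [sq_nonneg Q]
  by_cases hcz : c = 0
  · left
    subst hcz
    have h1 : q ^ j * x = σ * y := by linarith
    rcases hσ with h | h
    · subst h; exact ⟨rfl, by linarith⟩
    · subst h; exfalso; linarith
  right
  have hjt : j = t := by
    by_contra hne
    have hlt : j + 1 ≤ t := by omega
    have hpq : q ^ j * q ≤ Q := by
      rw [hQ, ← pow_succ]; exact pow_le_pow_right₀ (by linarith) hlt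
    have h1 : q ^ j * q * x ≤ Q * (2 * q * Q + 2 * q - 1) :=
      mul_le_mul hpq hx (by linarith) (by linarith)
    have h2 : q * Q ^ 2 + 1 - (2 * q * Q + 2 * q - 1) ≤ q ^ j * x := by
      have : 1 ≤ c := by omega
      nlinarith [sq_nonneg Q]
    have h3 : q * (q * Q ^ 2 + 1 - (2 * q * Q + 2 * q - 1)) ≤ Q * (2 * q * Q + 2 * q - 1) := by
      refine le_trans (mul_le_mul_of_nonneg_left h2 (by linarith)) ?_
      linarith [mul_comm (q ^ j) q, mul_assoc q (q ^ j) x, congrArg (· * x) (mul_comm (q ^ j) q)]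
    have hq0 : 0 ≤ q := by linarith
    have hQ0 : 0 ≤ Q := by linarith
    have h4 := mul_nonneg (mul_nonneg hq0 (sq_nonneg Q)) (sub_nonneg.2 hq)
    have h5 := mul_nonneg (mul_nonneg hq0 hQ0) (sub_nonneg.2 hQ3)
    have h6 := mul_nonneg (mul_nonneg hq0 hQ0) (sub_nonneg.2 hq)
    have h7 := mul_nonneg hq0 (sub_nonneg.2 hQ3)
    have h8 := mul_nonneg hq0 (sub_nonneg.2 hq)
    clear hys hy2 hy3 hpx hpx1 hpq h1 h2 hc hx hy
    ring_nf at h3 h4 h5 h6 h7 h8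
    linarith
  subst hjt
  rw [← hQ] at hc hpx hpx1
  have hQpos : 0 < Q := by linarith
  have hc12 : c = 1 ∨ c = 2 := by omega
  rcases hc12 with h | h
  · left
    subst h
    refine ⟨x - q * Q, ?_, ?_, by ring, by linarith [sq Q, mul_assoc q Q Q]⟩
    · have : Q * (x - q * Q) = σ * y + 1 := by linarith [sq Q, mul_assoc q Q Q]
      by_contra h
      have : x - q * Q ≤ -(2 * q) - 1 := by omega
      nlinarith
    · have : Q * (x - q * Q) = σ * y + 1 := by linarith [sq Q, mul_assoc q Q Q]
      by_contra h
      have : 2 * q + 1 ≤ x - q * Q := by omega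
      nlinarith
  · right
    subst h
    refine ⟨x - 2 * q * Q, ?_, by linarith, by ring, by linarith [sq Q, mul_assoc q Q Q]⟩
    have : Q * (x - 2 * q * Q) = σ * y + 2 := by linarith [sq Q, mul_assoc q Q Q]
    by_contra h
    have : x - 2 * q * Q ≤ -(2 * q) - 1 := by omega
    nlinarith

/-- The parameters of the problem, over the integers: `Q = q^t`, `lam * n = q^(2t+1)+1`,
`lam * A = q^(t+1)+1`, `lam * D = q^t-1`, `lam * E = q+1`. -/
structure Par (q lam Q n A D E : ℤ) (t : ℕ) : Prop where
  q3 : 3 ≤ q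
  l2 : 2 ≤ lam
  hQ : Q = q ^ t
  hQ2 : q * q ≤ Q
  hE : lam * E = q + 1
  hD : lam * D = Q - 1
  hA : lam * A = q * Q + 1
  hn : lam * n = q * Q ^ 2 + 1

namespace Par
variable {q lam Q n A D E : ℤ} {t : ℕ}

lemma Q3 (P : Par q lam Q n A D E t) : 3 * q ≤ Q := by nlinarith [P.q3, P.hQ2]

lemma AQ (P : Par q lam Q n A D E t) : A * Q = n + D := by
  have h : lam ≠ 0 := by linarith [P.l2]
  apply mul_left_cancel₀ h
  linear_combination Q * P.hA - P.hn - P.hD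

lemma EQ (P : Par q lam Q n A D E t) : E * Q = A + D := by
  have h : lam ≠ 0 := by linarith [P.l2]
  apply mul_left_cancel₀ h
  linear_combination Q * P.hE - P.hA - P.hD

lemma dvd_of (P : Par q lam Q n A D E t) {s : ℤ} (h : q ∣ lam * s) : q ∣ s := by
  have h1 : s = E * (lam * s) - q * s := by linear_combination (-s) * P.hE
  rw [h1]
  exact dvd_sub (h.mul_left E) (dvd_mul_right q s)

lemma lam_ne_q (P : Par q lam Q n A D E t) (a : ℤ) : lam * a ≠ q := by
  intro h
  have h1 : lam * (E - a) = 1 := by linear_combination P.hE - h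
  have h2 : lam ∣ 1 := ⟨_, h1.symm⟩
  have := Int.le_of_dvd (by norm_num) h2
  linarith [P.l2]

lemma pair (P : Par q lam Q n A D E t) {s s' σ : ℤ} {j : ℕ} (hj : j ≤ t)
    (hs : 1 ≤ s) (hs' : 1 ≤ s') (hb : lam * s ≤ 2 * q * Q + 2 * q - 1)
    (hb' : lam * s' ≤ 2 * q * Q + 2 * q - 1) (hσ : σ = 1 ∨ σ = -1)
    (hd : n ∣ q ^ j * s - σ * s') :
    (σ = 1 ∧ s' = q ^ j * s) ∨
    (∃ a, -(2 * q) ≤ 1 + lam * a ∧ 1 + lam * a ≤ 2 * q ∧ s = A + a ∧ σ * s' = D + a * Q) ∨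
    (∃ a, -(2 * q) ≤ 2 + lam * a ∧ 2 + lam * a ≤ 2 * q - 1 ∧ s = 2 * A + a ∧
      σ * s' = 2 * D + a * Q) := by
  have h : lam ≠ 0 := by linarith [P.l2]
  have hd' : q * Q ^ 2 + 1 ∣ q ^ j * (lam * s) - σ * (lam * s') := by
    have e : q ^ j * (lam * s) - σ * (lam * s') = lam * (q ^ j * s - σ * s') := by ring
    rw [← P.hn, e]
    exact mul_dvd_mul_left lam hd
  rcases key_cong q Q (lam * s) (lam * s') σ t j P.q3 P.hQ P.hQ2 hj (by nlinarith [P.l2])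
    (by nlinarith [P.l2]) hb hb' hσ hd' with ⟨h1, h2⟩ | ⟨u, h1, h2, h3, h4⟩ | ⟨u, h1, h2, h3, h4⟩
  · left
    refine ⟨h1, mul_left_cancel₀ h ?_⟩
    linear_combination h2
  · right; left
    have hu : u = 1 + lam * (s - A) := by linear_combination (-1) * h3 + P.hA
    rw [hu] at h1 h2 h4
    refine ⟨s - A, h1, h2, by ring, mul_left_cancel₀ h ?_⟩
    linear_combination h4 - P.hD
  · right; right
    have hu : u = 2 + lam * (s - 2 * A) := by linear_combination (-1) * h3 + 2 * P.hA
    rw [hu] at h1 h2 h4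
    refine ⟨s - 2 * A, h1, h2, by ring, mul_left_cancel₀ h ?_⟩
    linear_combination h4 - 2 * P.hD

lemma cong_inj (P : Par q lam Q n A D E t) {s σ : ℤ} {j : ℕ} (hj : j ≤ t)
    (hs : 1 ≤ s) (hb : lam * s ≤ 2 * q * Q + 2 * q - 1) (hσ : σ = 1 ∨ σ = -1)
    (hd : n ∣ q ^ j * s - σ * s) : σ = 1 ∧ j = 0 := by
  have hQ3 := P.Q3
  have hq3 := P.q3
  have hl2 := P.l2
  rcases P.pair hj hs hs hb hb hσ hd with ⟨h1, h2⟩ | ⟨a, h1, h2, h3, h4⟩ | ⟨a, h1, h2, h3, h4⟩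
  · refine ⟨h1, ?_⟩
    by_contra hj0
    have : 1 < q ^ j := one_lt_pow₀ (by linarith) hj0
    nlinarith
  · exfalso
    have e1 : lam * s = q * Q + 1 + lam * a := by rw [h3]; linear_combination P.hA
    have e2 : lam * (σ * s) = Q - 1 + lam * a * Q := by rw [h4]; linear_combination P.hD
    rcases hσ with h | h <;> subst h
    · have : (lam * a + 1 - q) * Q = lam * a + 2 := by linear_combination e1 - e2
      have h5 : lam * a + 1 - q ≤ 0 ∨ 1 ≤ lam * a + 1 - q := by omega
      rcases h5 with h5 | h5 <;> nlinarith
    · have : (lam * a + 1 + q) * Q = - (lam * a) := by linear_combination - e1 - e2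
      have h5 : lam * a + 1 + q ≤ -1 ∨ lam * a + 1 + q = 0 ∨ 1 ≤ lam * a + 1 + q := by omega
      rcases h5 with h5 | h5 | h5 <;> nlinarith
  · exfalso
    have e1 : lam * s = 2 * q * Q + 2 + lam * a := by rw [h3]; linear_combination 2 * P.hA
    have e2 : lam * (σ * s) = 2 * Q - 2 + lam * a * Q := by rw [h4]; linear_combination 2 * P.hD
    rcases hσ with h | h <;> subst h
    · have : (lam * a + 2 - 2 * q) * Q = lam * a + 4 := by linear_combination e1 - e2
      have h5 : lam * a + 2 - 2 * q ≤ -1 := by omega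
      nlinarith
    · have : (lam * a + 2 + 2 * q) * Q = - (lam * a) := by linear_combination - e1 - e2
      have h5 : lam * a + 2 + 2 * q = 0 ∨ 1 ≤ lam * a + 2 + 2 * q := by omega
      rcases h5 with h5 | h5 <;> nlinarith

/-- The list of exceptional elements. -/
def Exc (q lam Q A D s : ℤ) : Prop :=
  (∃ a, -q ≤ lam * a ∧ lam * a ≤ q - 2 ∧ s = A + a) ∨
  (∃ a, 0 ≤ a ∧ lam * a ≤ q - 2 ∧ s = A + 2 * D + a * Q) ∨
  (∃ a, 1 ≤ a ∧ lam * a ≤ q ∧ s = A + a * Q) ∨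
  (∃ a, -(2 * q + 1) ≤ lam * a ∧ s = 2 * A + a)

lemma exc_of (P : Par q lam Q n A D E t) {s s' σ : ℤ} {j : ℕ} (hj : j ≤ t)
    (hs' : 1 ≤ s') (hss : s' < s) (hb : lam * s ≤ 2 * q * Q + 2 * q - 1)
    (hσ : σ = 1 ∨ σ = -1) (hqs : ¬ q ∣ s)
    (hd : n ∣ q ^ j * s - σ * s') : Exc q lam Q A D s := by
  have hQ3 := P.Q3
  have hq3 := P.q3
  have hl2 := P.l2
  have hlt : lam * s' < lam * s := by nlinarith
  have hl0 : 0 < lam * s' := by nlinarith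
  have hqQ : q ∣ Q := by
    rw [P.hQ]; apply dvd_pow_self; rintro rfl; have := P.hQ; simp at this; linarith
  rcases P.pair hj (by linarith) hs' hb (by linarith) hσ hd with
    ⟨h1, h2⟩ | ⟨a, h1, h2, h3, h4⟩ | ⟨a, h1, h2, h3, h4⟩
  · exfalso
    have : 1 ≤ q ^ j := one_le_pow₀ (by linarith)
    nlinarith
  · left
    have e1 : lam * s = q * Q + 1 + lam * a := by rw [h3]; linear_combination P.hA
    have e2 : lam * (σ * s') = Q - 1 + lam * a * Q := by rw [h4]; linear_combination P.hD
    refine ⟨a, ?_, ?_, h3⟩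
    · rcases hσ with h | h <;> subst h
      · have : 0 ≤ lam * a := by
          by_contra hh
          have : lam * a ≤ -1 := by omega
          nlinarith
        linarith
      · have : (lam * a + 1 + q) * Q > - (lam * a) := by linarith
        by_contra hh
        have h5 : lam * a + 1 + q ≤ 0 := by omega
        nlinarith
    · rcases hσ with h | h <;> subst h
      · have : (lam * a + 1 - q) * Q < lam * a + 2 := by linarith
        have h5 : lam * a + 1 - q ≤ 0 := by
          by_contra hh
          have : 1 ≤ lam * a + 1 - q := by omega
          nlinarith
        have h6 : lam * a ≠ q - 1 := by
          intro h6
          apply hqs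
          apply P.dvd_of
          rw [e1, h6]
          have : q * Q + 1 + (q - 1) = q * (Q + 1) := by ring
          rw [this]; exact dvd_mul_right _ _
        omega
      · have : lam * a ≤ 0 := by
          by_contra hh
          have : 1 ≤ lam * a := by omega
          nlinarith
        linarith
  · right; right; right
    have e1 : lam * s = 2 * q * Q + 2 + lam * a := by rw [h3]; linear_combination 2 * P.hA
    refine ⟨a, ?_, h3⟩
    have h6 : lam * a ≠ - 2 * q - 2 := by
      intro h6
      apply hqs
      apply P.dvd_of
      rw [e1, h6]
      have : 2 * q * Q + 2 + (- 2 * q - 2) = q * (2 * Q - 2) := by ring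
      rw [this]; exact dvd_mul_right _ _
    omega

lemma exc_of' (P : Par q lam Q n A D E t) {s s' σ : ℤ} {j : ℕ} (hj : j ≤ t)
    (hs' : 1 ≤ s') (hss : s' < s) (hb : lam * s ≤ 2 * q * Q + 2 * q - 1)
    (hσ : σ = 1 ∨ σ = -1) (hqs : ¬ q ∣ s)
    (hd : n ∣ q ^ j * s' - σ * s) : Exc q lam Q A D s := by
  have hQ3 := P.Q3
  have hq3 := P.q3
  have hl2 := P.l2
  have hEQ := P.EQ
  have hlt : lam * s' < lam * s := by nlinarith
  have hl0 : 0 < lam * s' := by nlinarith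
  rcases P.pair hj hs' (by linarith) (by linarith) hb hσ hd with
    ⟨h1, h2⟩ | ⟨a, h1, h2, h3, h4⟩ | ⟨a, h1, h2, h3, h4⟩
  · exfalso
    by_cases hj0 : j = 0
    · subst hj0; simp at h2; linarith
    · exact hqs (h2 ▸ (dvd_pow_self q hj0).mul_right _)
  · have e1 : lam * s' = q * Q + 1 + lam * a := by rw [h3]; linear_combination P.hA
    have e2 : lam * (σ * s) = Q - 1 + lam * a * Q := by rw [h4]; linear_combination P.hD
    have hE := P.hE
    rcases hσ with h | h <;> subst h
    · right; left
      have h0 : 0 ≤ lam * a := by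
        by_contra hh
        have : lam * a ≤ -1 := by omega
        nlinarith
      have : (lam * a + 1 - q) * Q > lam * a + 2 := by linarith
      have h5 : 1 ≤ lam * a + 1 - q := by
        by_contra hh
        have : lam * a + 1 - q ≤ 0 := by omega
        nlinarith
      have h6 := P.lam_ne_q a
      have h7 : q + 1 ≤ lam * a := by omega
      refine ⟨a - E, ?_, ?_, ?_⟩
      · have : 0 ≤ lam * (a - E) := by rw [mul_sub, hE]; linarith
        exact nonneg_of_mul_nonneg_right this (by linarith)
      · rw [mul_sub, hE]; linarith
      · linear_combination h4 + hEQ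
    · have : (lam * a + 1 + q) * Q < - (lam * a) := by linarith
      have h5 : lam * a + 1 + q ≤ 0 := by
        by_contra hh
        have : 1 ≤ lam * a + 1 + q := by omega
        nlinarith
      have h6 : 0 ≤ -a - E := by
        have : 0 ≤ lam * (-a - E) := by rw [mul_sub, hE]; linarith
        exact nonneg_of_mul_nonneg_right this (by linarith)
      have h7 : s = A + (- a - E) * Q := by linear_combination (-1) * h4 + hEQ
      by_cases h8 : -a - E = 0
      · left
        refine ⟨0, by linarith, by linarith, ?_⟩
        rw [h7, h8]; ring
      · right; right; left
        refine ⟨-a - E, by omega, ?_, h7⟩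
        rw [mul_sub, hE]; linarith
  · have e1 : lam * s' = 2 * q * Q + 2 + lam * a := by rw [h3]; linear_combination 2 * P.hA
    have e2 : lam * (σ * s) = 2 * Q - 2 + lam * a * Q := by rw [h4]; linear_combination 2 * P.hD
    rcases hσ with h | h <;> subst h
    · exfalso
      have : (lam * a + 2 - 2 * q) * Q > lam * a + 4 := by linarith
      have h5 : lam * a + 2 - 2 * q ≤ -1 := by omega
      nlinarith
    · right; right; right
      have : (lam * a + 2 + 2 * q) * Q < - (lam * a) := by linarith
      have h5 : lam * a + 2 + 2 * q = 0 := by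
        by_contra hh
        have : 1 ≤ lam * a + 2 + 2 * q := by omega
        nlinarith
      have h6 : s = 2 * A := by
        have h : lam ≠ 0 := by linarith
        apply mul_left_cancel₀ h
        linear_combination - e2 - Q * h5 - 2 * P.hA
      exact ⟨0, by linarith, by linarith⟩

/-- Exceptional elements are not leaders. -/
lemma of_exc (P : Par q lam Q n A D E t) {s : ℤ}
    (hb : lam * s ≤ 2 * q * Q + 2 * q - 1) (hex : Exc q lam Q A D s) :
    ∃ s' σ : ℤ, (σ = 1 ∨ σ = -1) ∧ 1 ≤ s' ∧ s' < s ∧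
      (n ∣ Q * s - σ * s' ∨ n ∣ Q * s' - σ * s) := by
  have hQ3 := P.Q3
  have hq3 := P.q3
  have hl2 := P.l2
  have hEQ := P.EQ
  have hAQ := P.AQ
  have hl : 0 < lam := by linarith
  have hqQ : q ∣ Q := by
    rw [P.hQ]; apply dvd_pow_self; rintro rfl; have := P.hQ; simp at this; linarith
  rcases hex with ⟨a, h1, h2, h3⟩ | ⟨a, h1, h2, h3⟩ | ⟨a, h1, h2, h3⟩ | ⟨a, h1, h3⟩
  · by_cases ha : 0 ≤ a
    · refine ⟨D + a * Q, 1, Or.inl rfl, ?_, ?_, Or.inl ⟨1, ?_⟩⟩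
      · have : 0 < lam * (D + a * Q) := by
          have e : lam * (D + a * Q) = Q - 1 + lam * a * Q := by linear_combination P.hD
          rw [e]; nlinarith [mul_nonneg hl.le ha]
        have := pos_of_mul_pos_right this hl.le
        omega
      · apply lt_of_mul_lt_mul_left _ hl.le
        have e : lam * (D + a * Q) = Q - 1 + lam * a * Q := by linear_combination P.hD
        have e1 : lam * s = q * Q + 1 + lam * a := by rw [h3]; linear_combination P.hA
        rw [e, e1]; nlinarith [mul_nonneg hl.le ha]
      · rw [h3]; linear_combination hAQ
    · have ha' : lam * a ≤ -lam := by nlinarith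
      refine ⟨-(D + a * Q), -1, Or.inr rfl, ?_, ?_, Or.inl ⟨1, ?_⟩⟩
      · have : 0 < lam * -(D + a * Q) := by
          have e : lam * -(D + a * Q) = -(Q - 1 + lam * a * Q) := by linear_combination - P.hD
          rw [e]; nlinarith
        have := pos_of_mul_pos_right this hl.le
        omega
      · apply lt_of_mul_lt_mul_left _ hl.le
        have e : lam * -(D + a * Q) = -(Q - 1 + lam * a * Q) := by linear_combination - P.hD
        have e1 : lam * s = q * Q + 1 + lam * a := by rw [h3]; linear_combination P.hA
        rw [e, e1]; nlinarith 
      · rw [h3]; linear_combination hAQ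
  · have ha' := mul_nonneg hl.le h1
    have e0 : lam * (A + E + a) = q * Q + 1 + q + 1 + lam * a := by linear_combination P.hA + P.hE
    refine ⟨A + E + a, 1, Or.inl rfl, ?_, ?_, Or.inr ⟨1, ?_⟩⟩
    · have : 0 < lam * (A + E + a) := by rw [e0]; nlinarith
      have := pos_of_mul_pos_right this hl.le
      omega
    · apply lt_of_mul_lt_mul_left _ hl.le
      have e1 : lam * s = q * Q + 1 + 2 * (Q - 1) + lam * a * Q := by
        rw [h3]; linear_combination P.hA + 2 * P.hD
      rw [e0, e1]; nlinarith
    · rw [h3]; linear_combination hAQ + hEQ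
  · have ha' : lam ≤ lam * a := by nlinarith
    have e0 : lam * (A - E - a) = q * Q + 1 - q - 1 - lam * a := by linear_combination P.hA - P.hE
    refine ⟨A - E - a, -1, Or.inr rfl, ?_, ?_, Or.inr ⟨1, ?_⟩⟩
    · have : 0 < lam * (A - E - a) := by rw [e0]; nlinarith
      have := pos_of_mul_pos_right this hl.le
      omega
    · apply lt_of_mul_lt_mul_left _ hl.le
      have e1 : lam * s = q * Q + 1 + lam * a * Q := by
        rw [h3]; linear_combination P.hA
      rw [e0, e1]; nlinarith
    · rw [h3]; linear_combination hAQ - hEQ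
  · have e1 : lam * s = 2 * q * Q + 2 + lam * a := by rw [h3]; linear_combination 2 * P.hA
    by_cases ha : 1 ≤ 2 + lam * a
    · have e : lam * (2 * D + a * Q) = (2 + lam * a) * Q - 2 := by linear_combination 2 * P.hD
      refine ⟨2 * D + a * Q, 1, Or.inl rfl, ?_, ?_, Or.inl ⟨2, ?_⟩⟩
      · have : 0 < lam * (2 * D + a * Q) := by
          rw [e]; nlinarith
        have := pos_of_mul_pos_right this hl.le
        omega
      · apply lt_of_mul_lt_mul_left _ hl.le
        rw [e, e1]
        have : 2 + lam * a ≤ 2 * q - 1 := by linarith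
        nlinarith
      · rw [h3]; linear_combination 2 * hAQ
    · have e : lam * -(2 * D + a * Q) = -((2 + lam * a) * Q) + 2 := by linear_combination -2 * P.hD
      refine ⟨-(2 * D + a * Q), -1, Or.inr rfl, ?_, ?_, Or.inl ⟨2, ?_⟩⟩
      · have : 0 < lam * -(2 * D + a * Q) := by
          rw [e]; nlinarith
        have := pos_of_mul_pos_right this hl.le
        omega
      · apply lt_of_mul_lt_mul_left _ hl.le
        rw [e, e1]
        have : 1 - 2 * q ≤ 2 + lam * a := by linarith
        nlinarith
      · rw [h3]; linear_combination 2 * hAQ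

end Par


lemma mem_cycCoset {q n s r : ℕ} (hn : 0 < n) (ho : 0 < orderOf (q : ZMod n)) :
    r ∈ cycCoset q n s ↔ r < n ∧ ∃ j : ℕ, (s : ZMod n) * (q : ZMod n) ^ j = r := by
  unfold cycCoset
  simp only [Finset.mem_image, Finset.mem_range]
  constructor
  · rintro ⟨j, hj, rfl⟩
    refine ⟨Nat.mod_lt _ hn, j, ?_⟩
    rw [ZMod.natCast_mod]; push_cast; rfl
  · rintro ⟨hr, j, hj⟩
    refine ⟨j % orderOf (q : ZMod n), Nat.mod_lt _ ho, ?_⟩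
    have h1 : ((s * q ^ (j % orderOf (q : ZMod n)) : ℕ) : ZMod n) = (r : ℕ) := by
      push_cast
      rw [pow_mod_orderOf, hj]
    rw [ZMod.natCast_eq_natCast_iff] at h1
    unfold Nat.ModEq at h1
    rw [h1, Nat.mod_eq_of_lt hr]

/-- Reduction of the exponent to the range `[0, t]`. -/
lemma reduce_exp {R : Type*} [CommRing R] {x s s' : R} {t j : ℕ} (hx : x ^ (2 * t + 1) = -1)
    (hj : j < 2 * (2 * t + 1)) (h : s * x ^ j = s') :
    ∃ i ≤ t, ∃ σ : ℤ, (σ = 1 ∨ σ = -1) ∧ (σ = 1 → 0 < j → 0 < i) ∧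
      (x ^ i * s = σ * s' ∨ x ^ i * s' = σ * s) := by
  by_cases h1 : j ≤ t
  · refine ⟨j, h1, 1, Or.inl rfl, fun _ h => h, Or.inl ?_⟩
    rw [← h]; push_cast; ring
  by_cases h2 : j ≤ 2 * t + 1
  · refine ⟨2 * t + 1 - j, by omega, -1, Or.inr rfl, fun h => by norm_num at h, Or.inr ?_⟩
    have e : 2 * t + 1 = j + (2 * t + 1 - j) := by omega
    rw [e, pow_add] at hx
    rw [← h]; push_cast
    linear_combination s * hx
  by_cases h3 : j ≤ 3 * t + 1
  · refine ⟨j - (2 * t + 1), by omega, -1, Or.inr rfl, fun h => by norm_num at h, Or.inl ?_⟩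
    have e : j = (2 * t + 1) + (j - (2 * t + 1)) := by omega
    rw [e, pow_add, hx] at h
    rw [← h]; push_cast
    ring
  · refine ⟨2 * (2 * t + 1) - j, by omega, 1, Or.inl rfl, fun _ _ => by omega, Or.inr ?_⟩
    have e : (2 * t + 1) + (2 * t + 1) = j + (2 * (2 * t + 1) - j) := by omega
    have h4 : x ^ j * x ^ (2 * (2 * t + 1) - j) = 1 := by
      rw [← pow_add, ← e, pow_add, hx]; ring
    rw [← h]; push_cast
    linear_combination s * h4

section
variable {q lam Q n A D E t : ℕ}

lemma Par.npos (P : Par q lam Q n A D E t) : 0 < n := by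
  rcases Nat.eq_zero_or_pos n with h | h
  · exfalso
    have h1 := P.hn
    have h2 := P.q3
    rw [h] at h1
    have : (0:ℤ) ≤ (q:ℤ) * (Q:ℤ) ^ 2 := by positivity
    push_cast at h1
    linarith
  · exact h

lemma Par.pow_eq (P : Par q lam Q n A D E t) : (q : ZMod n) ^ (2 * t + 1) = -1 := by
  have h : ((((q:ℤ) ^ (2 * t + 1) + 1 : ℤ)) : ZMod n) = 0 := by
    rw [ZMod.intCast_zmod_eq_zero_iff_dvd]
    refine ⟨lam, ?_⟩
    have h1 := P.hn
    rw [P.hQ] at h1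
    linear_combination -h1
  push_cast at h
  linear_combination h

lemma Par.dvd_of_eq {i : ℕ} {σ s s' : ℤ}
    (h : (q : ZMod n) ^ i * (s : ZMod n) = (σ : ZMod n) * (s' : ZMod n)) :
    (n : ℤ) ∣ (q : ℤ) ^ i * s - σ * s' := by
  rw [← ZMod.intCast_zmod_eq_zero_iff_dvd]
  push_cast
  rw [h]; ring

lemma Par.eq_of_dvd {i : ℕ} {σ s s' : ℤ}
    (h : (n : ℤ) ∣ (q : ℤ) ^ i * s - σ * s') :
    (q : ZMod n) ^ i * (s : ZMod n) = (σ : ZMod n) * (s' : ZMod n) := by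
  rw [← ZMod.intCast_zmod_eq_zero_iff_dvd] at h
  push_cast at h
  linear_combination h

lemma Par.inj (P : Par q lam Q n A D E t) {s j : ℕ} (hs : 1 ≤ s)
    (hb : lam * s ≤ 2 * q * Q + 2 * q - 1) (hj : j < 2 * (2 * t + 1)) (hj0 : 0 < j) :
    (s : ZMod n) * (q : ZMod n) ^ j ≠ s := by
  intro h
  have hq := P.q3
  obtain ⟨i, hi, σ, hσ, h1, h2⟩ := reduce_exp P.pow_eq hj h
  rw [or_self] at h2
  have h3 := Par.dvd_of_eq (n := n) (q := q) (i := i) (σ := σ) (s := s) (s' := s)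
    (by exact_mod_cast h2)
  have h4 := P.cong_inj hi (by exact_mod_cast hs) (by zify [show 1 ≤ 2 * q * Q + 2 * q by omega] at hb; exact hb) hσ h3
  have := h1 h4.1 hj0
  omega

lemma Par.one_le (P : Par q lam Q n A D E t) : lam * 1 ≤ 2 * q * Q + 2 * q - 1 := by
  have h1 : lam * E = q + 1 := by exact_mod_cast P.hE
  have h2 : 1 ≤ E := by
    rcases Nat.eq_zero_or_pos E with h | h
    · rw [h] at h1; omega
    · exact h
  have h3 : lam ≤ q + 1 := by nlinarith
  have h4 := P.q3
  omega

lemma Par.order (P : Par q lam Q n A D E t) : orderOf (q : ZMod n) = 2 * (2 * t + 1) := by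
  rw [orderOf_eq_iff (by omega)]
  constructor
  · rw [mul_comm, pow_mul, P.pow_eq]; ring
  · intro j hj hj0
    have := P.inj le_rfl P.one_le hj hj0
    simpa using this

lemma Par.card_coset (P : Par q lam Q n A D E t) {s : ℕ} (hs : 1 ≤ s)
    (hb : lam * s ≤ 2 * q * Q + 2 * q - 1) : (cycCoset q n s).card = 2 * (2 * t + 1) := by
  unfold cycCoset
  rw [P.order, Finset.card_image_of_injOn, Finset.card_range]
  have key : ∀ i j : ℕ, i < j → j < 2 * (2 * t + 1) → s * q ^ i % n ≠ s * q ^ j % n := by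
    intro i j hij hj h
    have h1 : ((s * q ^ i : ℕ) : ZMod n) = ((s * q ^ j : ℕ) : ZMod n) := by
      rw [ZMod.natCast_eq_natCast_iff]; exact h
    push_cast at h1
    have hx := P.pow_eq
    have e : 2 * t + 1 + (2 * t + 1) = i + (2 * (2 * t + 1) - i) := by omega
    have h4 : (q : ZMod n) ^ i * (q : ZMod n) ^ (2 * (2 * t + 1) - i) = 1 := by
      rw [← pow_add, ← e, pow_add, hx]; ring
    apply P.inj hs hb (j := j - i) (by omega) (by omega)
    have e2 : j = i + (j - i) := by omega
    rw [e2, pow_add] at h1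
    linear_combination (-(q : ZMod n) ^ (2 * (2 * t + 1) - i)) * h1 + (s : ZMod n) * h4 -
      (s : ZMod n) * (q : ZMod n) ^ (j - i) * h4
  intro i hi j hj h
  simp only [Finset.coe_range, Set.mem_Iio] at hi hj
  rcases lt_trichotomy i j with h1 | h1 | h1
  · exact absurd h (key i j h1 hj)
  · exact h1
  · exact absurd h.symm (key j i h1 hi)

lemma Par.mem (P : Par q lam Q n A D E t) {s r : ℕ} :
    r ∈ cycCoset q n s ↔ r < n ∧ ∃ j : ℕ, (s : ZMod n) * (q : ZMod n) ^ j = r :=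
  mem_cycCoset P.npos (by rw [P.order]; omega)

lemma Par.inv (P : Par q lam Q n A D E t) (j : ℕ) :
    ∃ k, (q : ZMod n) ^ j * (q : ZMod n) ^ k = 1 := by
  refine ⟨(4 * t + 1) * j, ?_⟩
  rw [← pow_add, show j + (4 * t + 1) * j = (2 * t + 1) * (2 * j) by ring, pow_mul, P.pow_eq]
  simp

lemma Par.subset (P : Par q lam Q n A D E t) {s s' j : ℕ}
    (h : (s' : ZMod n) * (q : ZMod n) ^ j = s) : cycCoset q n s ⊆ cycCoset q n s' := by
  intro r hr
  rw [P.mem] at hr ⊢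
  obtain ⟨h1, i, hi⟩ := hr
  refine ⟨h1, j + i, ?_⟩
  rw [← hi, ← h]; ring

lemma Par.disj (P : Par q lam Q n A D E t) {s s' : ℕ} (hss : s' < s) (hs' : 1 ≤ s')
    (hb : lam * s ≤ 2 * q * Q + 2 * q - 1) (hqs : ¬ q ∣ s) (hex : ¬ Par.Exc q lam Q A D s) :
    Disjoint (cycCoset q n s) (cycCoset q n s') := by
  rw [Finset.disjoint_left]
  intro r hr hr'
  rw [P.mem] at hr hr'
  obtain ⟨-, i, hi⟩ := hr
  obtain ⟨-, j, hj⟩ := hr'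
  obtain ⟨k, hk⟩ := P.inv j
  have h1 : (s : ZMod n) * (q : ZMod n) ^ ((i + k) % (2 * (2 * t + 1))) = s' := by
    have h2 := pow_mod_orderOf (q : ZMod n) (i + k)
    rw [P.order] at h2
    rw [h2, pow_add]
    linear_combination (q : ZMod n) ^ k * hi - (q : ZMod n) ^ k * hj + (s' : ZMod n) * hk
  obtain ⟨l, hl, σ, hσ, -, h2⟩ := reduce_exp P.pow_eq (Nat.mod_lt _ (by omega)) h1
  have hq := P.q3
  have hb' : (lam : ℤ) * s ≤ 2 * q * Q + 2 * q - 1 := by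
    zify [show 1 ≤ 2 * q * Q + 2 * q by omega] at hb; exact hb
  apply hex
  rcases h2 with h2 | h2
  · exact P.exc_of hl (by exact_mod_cast hs') (by exact_mod_cast hss) hb' hσ
      (by exact_mod_cast hqs) (Par.dvd_of_eq (s := s) (s' := s') (by exact_mod_cast h2))
  · exact P.exc_of' hl (by exact_mod_cast hs') (by exact_mod_cast hss) hb' hσ
      (by exact_mod_cast hqs) (Par.dvd_of_eq (s := s') (s' := s) (by exact_mod_cast h2))

lemma Par.rel_of (P : Par q lam Q n A D E t) {x y : ZMod n} {σ : ℤ} (hσ : σ = 1 ∨ σ = -1)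
    (h : (q : ZMod n) ^ t * x = σ * y) :
    (∃ j : ℕ, y * (q : ZMod n) ^ j = x) ∧ (∃ j : ℕ, x * (q : ZMod n) ^ j = y) := by
  have h1 : ∃ j : ℕ, x * (q : ZMod n) ^ j = y := by
    rcases hσ with h1 | h1 <;> subst h1
    · exact ⟨t, by rw [mul_comm, h]; simp⟩
    · refine ⟨t + (2 * t + 1), ?_⟩
      rw [pow_add, P.pow_eq]
      push_cast at h
      linear_combination -h
  refine ⟨?_, h1⟩
  obtain ⟨j, hj⟩ := h1
  obtain ⟨k, hk⟩ := P.inv j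
  exact ⟨k, by rw [← hj]; linear_combination x * hk⟩

lemma Par.nonleader (P : Par q lam Q n A D E t) {s : ℕ} (hs : 1 ≤ s)
    (hb : lam * s ≤ 2 * q * Q + 2 * q - 1) (h : q ∣ s ∨ Par.Exc q lam Q A D s) :
    ∃ s', 1 ≤ s' ∧ s' < s ∧ cycCoset q n s ⊆ cycCoset q n s' := by
  have hq := P.q3
  have hb' : (lam : ℤ) * s ≤ 2 * q * Q + 2 * q - 1 := by
    zify [show 1 ≤ 2 * q * Q + 2 * q by omega] at hb; exact hb
  rcases h with ⟨r, rfl⟩ | h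
  · refine ⟨r, ?_, ?_, P.subset (j := 1) (by push_cast; ring)⟩
    · rcases Nat.eq_zero_or_pos r with h | h
      · subst h; simp at hs
      · exact h
    · have : 1 ≤ r := by
        rcases Nat.eq_zero_or_pos r with h | h
        · subst h; simp at hs
        · exact h
      have h3 : 3 ≤ q := by exact_mod_cast hq
      nlinarith
  · obtain ⟨s', σ, hσ, h1, h2, h3⟩ := P.of_exc hb' h
    lift s' to ℕ using by linarith
    refine ⟨s', by exact_mod_cast h1, by exact_mod_cast h2, ?_⟩
    have h4 : ∃ j : ℕ, (s' : ZMod n) * (q : ZMod n) ^ j = s := by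
      rw [P.hQ] at h3
      rcases h3 with h3 | h3
      · have := Par.eq_of_dvd h3
        exact (P.rel_of (x := s) (y := s') hσ (by exact_mod_cast this)).1
      · have := Par.eq_of_dvd h3
        exact (P.rel_of (x := s') (y := s) hσ (by exact_mod_cast this)).2
    obtain ⟨j, hj⟩ := h4
    exact P.subset hj

open Classical in
lemma Par.card_union (P : Par q lam Q n A D E t) (d : ℕ)
    (hb : lam * d ≤ 2 * q * Q + 2 * q - 1) :
    ((Finset.Icc 1 d).biUnion (cycCoset q n)).card =
      2 * (2 * t + 1) *
        ((Finset.Icc 1 d).filter fun s : ℕ => ¬ (q ∣ s ∨ Par.Exc q lam Q A D s)).card := by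
  induction d with
  | zero => simp
  | succ d ih =>
    have ih := ih (le_trans (Nat.mul_le_mul_left _ (Nat.le_succ d)) hb)
    have e : Finset.Icc 1 (d + 1) = insert (d + 1) (Finset.Icc 1 d) := by
      ext x; simp only [Finset.mem_Icc, Finset.mem_insert]; omega
    rw [e, Finset.biUnion_insert, Finset.filter_insert]
    by_cases h : q ∣ (d + 1) ∨ Par.Exc q lam Q A D ((d + 1 : ℕ) : ℤ)
    · rw [if_neg (not_not.2 h), ← ih]
      obtain ⟨s', h1, h2, h3⟩ := P.nonleader (by omega) hb h
      congr 1
      apply Finset.union_eq_right.2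
      refine h3.trans ?_
      exact Finset.subset_biUnion_of_mem (cycCoset q n) (by rw [Finset.mem_Icc]; omega)
    · rw [if_pos h, Finset.card_insert_of_notMem (by simp), Finset.card_union_of_disjoint, ih,
        P.card_coset (by omega) hb]
      · ring
      · rw [Finset.disjoint_biUnion_right]
        intro s' hs'
        rw [Finset.mem_Icc] at hs'
        rw [not_or] at h
        exact P.disj (by omega) hs'.1 hb h.1 h.2

end

section
variable {q lam Q n A D E t : ℕ}

lemma Par.exc_nat (P : Par q lam Q n A D E t) (s : ℕ) :
    Par.Exc q lam Q A D s ↔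
      ((A - q / lam ≤ s ∧ s ≤ A + (q - 2) / lam) ∨
      (∃ a, a ≤ (q - 2) / lam ∧ s = A + 2 * D + a * Q) ∨
      (∃ a, a + 1 ≤ q / lam ∧ s = A + (a + 1) * Q) ∨ 2 * A - (2 * q + 1) / lam ≤ s) := by
  have hq : 3 ≤ q := by exact_mod_cast P.q3
  have hl : 0 < lam := by have := P.l2; omega
  have hlz : (0 : ℤ) < lam := by exact_mod_cast hl
  unfold Par.Exc
  refine or_congr ?_ (or_congr ?_ (or_congr ?_ ?_))
  · constructor
    · rintro ⟨a, h1, h2, h3⟩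
      constructor
      · by_cases ha : 0 ≤ a
        · generalize q / lam = α
          omega
        · have : a.natAbs ≤ q / lam := by
            rw [Nat.le_div_iff_mul_le hl]
            zify
            rw [abs_of_neg (by omega)]
            nlinarith
          omega
      · by_cases ha : a ≤ 0
        · generalize (q - 2) / lam = β
          omega
        · have : a.natAbs ≤ (q - 2) / lam := by
            rw [Nat.le_div_iff_mul_le hl]
            zify [show 2 ≤ q by omega]
            rw [abs_of_pos (by omega)]
            nlinarith
          omega
    · rintro ⟨h1, h2⟩
      refine ⟨(s : ℤ) - A, ?_, ?_, by ring⟩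
      · have h3 : lam * (q / lam) ≤ q := Nat.mul_div_le q lam
        have h4 : (A : ℤ) - s ≤ (q / lam : ℕ) := by omega
        have h5 : (lam : ℤ) * (q / lam : ℕ) ≤ q := by exact_mod_cast h3
        nlinarith
      · have h3 : lam * ((q - 2) / lam) ≤ q - 2 := Nat.mul_div_le _ lam
        have h4 : (s : ℤ) - A ≤ ((q - 2) / lam : ℕ) := by omega
        have h5 : (lam : ℤ) * ((q - 2) / lam : ℕ) ≤ q - 2 := by
          have h6 : ((lam * ((q - 2) / lam) : ℕ) : ℤ) ≤ ((q - 2 : ℕ) : ℤ) := Int.ofNat_le.2 h3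
          rw [Nat.cast_mul, Nat.cast_sub (by omega)] at h6
          exact h6
        nlinarith
  · constructor
    · rintro ⟨a, h1, h2, h3⟩
      lift a to ℕ using h1
      refine ⟨a, ?_, by exact_mod_cast h3⟩
      rw [Nat.le_div_iff_mul_le hl]
      zify [show 2 ≤ q by omega]
      linarith
    · rintro ⟨a, h1, h2⟩
      rw [Nat.le_div_iff_mul_le hl] at h1
      zify [show 2 ≤ q by omega] at h1
      exact ⟨a, by positivity, by linarith, by exact_mod_cast h2⟩
  · constructor
    · rintro ⟨a, h1, h2, h3⟩
      lift a to ℕ using by linarith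
      obtain ⟨b, rfl⟩ : ∃ b, a = b + 1 := ⟨a - 1, by omega⟩
      refine ⟨b, ?_, by exact_mod_cast h3⟩
      rw [Nat.le_div_iff_mul_le hl]
      zify
      push_cast at h2
      linarith
    · rintro ⟨a, h1, h2⟩
      rw [Nat.le_div_iff_mul_le hl] at h1
      zify at h1
      exact ⟨a + 1, by linarith [Int.natCast_nonneg a], by linarith, by exact_mod_cast h2⟩
  · constructor
    · rintro ⟨a, h1, h3⟩
      by_cases ha : 0 ≤ a
      · generalize (2 * q + 1) / lam = γ
        omega
      · have : a.natAbs ≤ (2 * q + 1) / lam := by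
          rw [Nat.le_div_iff_mul_le hl]
          zify
          rw [abs_of_neg (by omega)]
          nlinarith
        omega
    · intro h1
      refine ⟨(s : ℤ) - 2 * A, ?_, by ring⟩
      have h3 : lam * ((2 * q + 1) / lam) ≤ 2 * q + 1 := Nat.mul_div_le _ lam
      have h4 : 2 * (A : ℤ) - s ≤ ((2 * q + 1) / lam : ℕ) := by omega
      have h5 : (lam : ℤ) * ((2 * q + 1) / lam : ℕ) ≤ 2 * q + 1 := by exact_mod_cast h3
      nlinarith

lemma Par.not_dvd (P : Par q lam Q n A D E t) {s : ℕ} (hs : s < 2 * A - (2 * q + 1) / lam)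
    (h : Par.Exc q lam Q A D s) : ¬ q ∣ s := by
  intro hd
  have hq := P.q3
  have hl := P.l2
  have hqQ : (q : ℤ) ∣ Q := by
    rw [P.hQ]; apply dvd_pow_self; rintro rfl
    have := P.hQ; have := P.Q3; simp at *; linarith
  obtain ⟨c, hc⟩ := hqQ
  have hd' : (q : ℤ) ∣ (lam : ℤ) * s := Dvd.dvd.mul_left (by exact_mod_cast hd) _
  obtain ⟨r, hr⟩ := hd'
  have key : ∀ z : ℤ, (q : ℤ) * z ≠ 1 := by
    intro z hz
    have := Int.le_of_dvd (by norm_num) (Dvd.intro z hz)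
    linarith
  rcases h with ⟨a, h1, h2, h3⟩ | ⟨a, h1, h2, h3⟩ | ⟨a, h1, h2, h3⟩ | ⟨a, h1, h3⟩
  · have e : (q : ℤ) * (r - Q) = 1 + lam * a := by
      rw [h3] at hr; linear_combination - hr + P.hA
    have e0 : r - Q = 0 := by
      by_contra h0
      have : r - Q ≤ -1 ∨ 1 ≤ r - Q := by omega
      rcases this with h | h <;> nlinarith
    rw [e0] at e
    have e2 : (lam : ℤ) * (-a) = 1 := by linarith
    have := Int.le_of_dvd (by norm_num) (Dvd.intro _ e2)
    linarith
  · apply key (Q + 2 * c + lam * a * c - r)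
    rw [h3] at hr
    linear_combination hr - P.hA - 2 * P.hD - (2 + lam * a) * hc
  · apply key (r - Q - lam * a * c)
    rw [h3] at hr
    linear_combination -hr + P.hA + lam * a * hc
  · have : 2 * A - (2 * q + 1) / lam ≤ s := by
      by_cases ha : 0 ≤ a
      · generalize (2 * q + 1) / lam = γ
        omega
      · have hl0 : 0 < lam := by omega
        have : a.natAbs ≤ (2 * q + 1) / lam := by
          rw [Nat.le_div_iff_mul_le hl0]
          zify
          rw [abs_of_neg (by omega)]
          nlinarith
        omega
    omega

open Classical in
lemma Par.count (P : Par q lam Q n A D E t) {d e k2 k3 : ℕ}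
    (hd : d < 2 * A - (2 * q + 1) / lam)
    (he : ∀ s, A - q / lam ≤ s → (s ≤ A + (q - 2) / lam ∧ s ≤ d ↔ s ≤ e))
    (h2 : ∀ a, a ≤ (q - 2) / lam ∧ A + 2 * D + a * Q ≤ d ↔ a < k2)
    (h3 : ∀ a, a + 1 ≤ q / lam ∧ A + (a + 1) * Q ≤ d ↔ a < k3) :
    ((Finset.Icc 1 d).filter fun s : ℕ => ¬ (q ∣ s ∨ Par.Exc q lam Q A D s)).card
      + (e + 1 - (A - q / lam)) + k2 + k3 + d / q = d := by
  have hq : 3 ≤ q := by exact_mod_cast P.q3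
  have hl2 : 2 ≤ lam := by exact_mod_cast P.l2
  have hl : 0 < lam := by omega
  have hQ3 : 3 * q ≤ Q := by exact_mod_cast P.Q3
  have hA : lam * A = q * Q + 1 := by exact_mod_cast P.hA
  have hD : lam * D + 1 = Q := by zify; linarith [P.hD]
  have hβ : lam * ((q - 2) / lam) ≤ q - 2 := Nat.mul_div_le _ lam
  have hα : lam * (q / lam) ≤ q := Nat.mul_div_le _ lam
  have hβD : (q - 2) / lam < 2 * D := by
    by_contra h
    have : lam * (2 * D) ≤ lam * ((q - 2) / lam) := Nat.mul_le_mul_left _ (by omega)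
    have e : lam * (2 * D) = 2 * (lam * D) := by ring
    omega
  have hD0 : 0 < 2 * D := lt_of_le_of_lt (Nat.zero_le _) hβD
  have h2D : 2 * D < Q := by
    have : 2 * D ≤ lam * D := Nat.mul_le_mul_right _ hl2
    omega
  have hA1 : 1 ≤ A - q / lam := by
    have : q / lam < A := by
      by_contra h
      have h1 : lam * A ≤ lam * (q / lam) := Nat.mul_le_mul_left _ (by omega)
      have : q ≤ q * Q := Nat.le_mul_of_pos_right q (by omega)
      omega
    omega
  have hP := Finset.card_filter_add_card_filter_not (s := Finset.Icc 1 d)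
    (fun s : ℕ => (q ∣ s ∨ Par.Exc q lam Q A D s))
  have hset : (Finset.Icc 1 d).filter (fun s : ℕ => (q ∣ s ∨ Par.Exc q lam Q A D s)) =
      (Finset.Icc 1 d).filter (fun s : ℕ => q ∣ s) ∪ (Finset.Icc (A - q / lam) e ∪
        ((Finset.range k2).image (fun a => A + 2 * D + a * Q) ∪
          (Finset.range k3).image (fun a => A + (a + 1) * Q))) := by
    ext s
    simp only [Finset.mem_filter, Finset.mem_union, Finset.mem_image, Finset.mem_range,
      Finset.mem_Icc, P.exc_nat]
    constructor
    · rintro ⟨⟨h4, h5⟩, h6 | h6 | ⟨a, h6, rfl⟩ | ⟨a, h6, rfl⟩ | h6⟩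
      · exact Or.inl ⟨⟨h4, h5⟩, h6⟩
      · exact Or.inr (Or.inl ⟨h6.1, (he s h6.1).1 ⟨h6.2, h5⟩⟩)
      · exact Or.inr (Or.inr (Or.inl ⟨a, (h2 a).1 ⟨h6, h5⟩, rfl⟩))
      · exact Or.inr (Or.inr (Or.inr ⟨a, (h3 a).1 ⟨h6, h5⟩, rfl⟩))
      · omega
    · rintro (⟨h4, h5⟩ | ⟨h4, h5⟩ | ⟨a, h4, rfl⟩ | ⟨a, h4, rfl⟩)
      · exact ⟨h4, Or.inl h5⟩
      · have := (he s h4).2 h5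
        exact ⟨⟨by omega, this.2⟩, Or.inr (Or.inl ⟨h4, this.1⟩)⟩
      · have := (h2 a).2 h4
        exact ⟨⟨by omega, this.2⟩, Or.inr (Or.inr (Or.inl ⟨a, this.1, rfl⟩))⟩
      · have := (h3 a).2 h4
        exact ⟨⟨by omega, this.2⟩, Or.inr (Or.inr (Or.inr (Or.inl ⟨a, this.1, rfl⟩)))⟩
  rw [hset, Finset.card_union_of_disjoint, Finset.card_union_of_disjoint,
    Finset.card_union_of_disjoint, Finset.card_image_of_injective, Finset.card_image_of_injective,
    Finset.card_range, Finset.card_range, Nat.card_Icc, Nat.card_Icc] at hP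
  · have hcm : ((Finset.Icc 1 d).filter (fun s : ℕ => q ∣ s)).card = d / q := by
      rw [← Nat.Ioc_filter_dvd_card_eq_div]
      congr 1
    rw [hcm] at hP
    omega
  · intro a b hab
    have : (a + 1) * Q = (b + 1) * Q := by simpa using hab
    have := Nat.eq_of_mul_eq_mul_right (by omega) this
    omega
  · intro a b hab
    have : a * Q = b * Q := by simpa using hab
    exact Nat.eq_of_mul_eq_mul_right (by omega) this
  · rw [Finset.disjoint_left]
    simp only [Finset.mem_image, Finset.mem_range, not_exists, not_and]
    rintro _ ⟨a, ha, rfl⟩ b hb h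
    rcases Nat.lt_or_ge a (b + 1) with h4 | h4
    · have : (a + 1) * Q ≤ (b + 1) * Q := Nat.mul_le_mul_right _ h4
      have e : (a + 1) * Q = a * Q + Q := by ring
      omega
    · have : (b + 1) * Q ≤ a * Q := Nat.mul_le_mul_right _ h4
      omega
  · rw [Finset.disjoint_left]
    simp only [Finset.mem_Icc, Finset.mem_union, Finset.mem_image, Finset.mem_range]
    rintro s ⟨h4, h5⟩ (⟨a, ha, h6⟩ | ⟨a, ha, h6⟩)
    · have := ((he s h4).2 h5).1
      have : 0 ≤ a * Q := Nat.zero_le _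
      omega
    · have := ((he s h4).2 h5).1
      have e : (a + 1) * Q = a * Q + Q := by ring
      have : 0 ≤ a * Q := Nat.zero_le _
      omega
  · rw [Finset.disjoint_left]
    simp only [Finset.mem_filter, Finset.mem_Icc, Finset.mem_union, Finset.mem_image,
      Finset.mem_range]
    rintro s ⟨⟨h4, h5⟩, h6⟩ h7
    refine P.not_dvd (by omega) ((P.exc_nat s).2 ?_) h6
    rcases h7 with ⟨h7, h8⟩ | ⟨a, h7, h8⟩ | ⟨a, h7, h8⟩
    · exact Or.inl ⟨h7, ((he s h7).2 h8).1⟩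
    · exact Or.inr (Or.inl ⟨a, ((h2 a).2 h7).1, h8.symm⟩)
    · exact Or.inr (Or.inr (Or.inl ⟨a, ((h3 a).2 h7).1, h8.symm⟩))

lemma Par.ceil_eq (q d : ℕ) (hq : 0 < q) :
    ⌈(d : ℚ) * (1 - (q : ℚ)⁻¹)⌉ = (d : ℤ) - (d / q : ℕ) := by
  have hq' : (0 : ℚ) < q := by exact_mod_cast hq
  have h1 : (d : ℚ) * (1 - (q : ℚ)⁻¹) = d - d / q := by field_simp
  have h2 : (d : ℚ) = q * (d / q : ℕ) + (d % q : ℕ) := by exact_mod_cast (Nat.div_add_mod d q).symm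
  have h3 : ((d % q : ℕ) : ℚ) < q := by exact_mod_cast Nat.mod_lt d hq
  have h4 : (0 : ℚ) ≤ ((d % q : ℕ) : ℚ) := by positivity
  have h5 : (d : ℚ) / q = (d / q : ℕ) + ((d % q : ℕ) : ℚ) / q := by
    rw [div_eq_iff hq'.ne', add_mul, div_mul_cancel₀ _ hq'.ne']
    linarith
  have h6 : ((d % q : ℕ) : ℚ) / q < 1 := by rw [div_lt_one hq']; exact h3
  have h7 : 0 ≤ ((d % q : ℕ) : ℚ) / q := by positivity
  rw [h1, Int.ceil_eq_iff, h5]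
  rw [Int.cast_sub, Int.cast_natCast, Int.cast_natCast]
  constructor <;> linarith

/-- Count below `κ`. -/
lemma Par.total (P : Par q lam Q n A D E t) {d e k2 k3 : ℕ}
    (hb : lam * d ≤ 2 * q * Q + 2 * q - 1)
    (hd : d < 2 * A - (2 * q + 1) / lam)
    (he : ∀ s, A - q / lam ≤ s → (s ≤ A + (q - 2) / lam ∧ s ≤ d ↔ s ≤ e))
    (h2 : ∀ a, a ≤ (q - 2) / lam ∧ A + 2 * D + a * Q ≤ d ↔ a < k2)
    (h3 : ∀ a, a + 1 ≤ q / lam ∧ A + (a + 1) * Q ≤ d ↔ a < k3) :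
    (((Finset.Icc 1 d).biUnion (cycCoset q n)).card : ℤ) =
      2 * ((2 * t + 1 : ℕ) : ℤ) * (⌈(d : ℚ) * (1 - (q : ℚ)⁻¹)⌉
        - (e + 1 - (A - q / lam) : ℕ) - k2 - k3) := by
  classical
  have hq : 3 ≤ q := by exact_mod_cast P.q3
  have h := P.count hd he h2 h3
  rw [P.card_union d hb, Par.ceil_eq q d (by omega)]
  push_cast
  congr 1
  have h4 : ((((Finset.Icc 1 d).filter fun s : ℕ => ¬ (q ∣ s ∨ Par.Exc q lam Q A D s)).card
      + (e + 1 - (A - q / lam)) + k2 + k3 + d / q : ℕ) : ℤ) = d := by exact_mod_cast h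
  rw [Nat.cast_add, Nat.cast_add, Nat.cast_add, Nat.cast_add] at h4
  push_cast at h4 ⊢
  linarith

/-- Nothing changes from `κ` on. -/
lemma Par.stable (P : Par q lam Q n A D E t) {d : ℕ}
    (hb : lam * d ≤ 2 * q * Q + 2 * q - 1) (hd : 2 * A - (2 * q + 1) / lam ≤ d) :
    ((Finset.Icc 1 d).biUnion (cycCoset q n)).card =
      ((Finset.Icc 1 (2 * A - (2 * q + 1) / lam - 1)).biUnion (cycCoset q n)).card := by
  classical
  rw [P.card_union d hb, P.card_union _ (le_trans (Nat.mul_le_mul_left _ (by omega)) hb)]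
  congr 2
  ext s
  simp only [Finset.mem_filter, Finset.mem_Icc]
  constructor
  · rintro ⟨⟨h1, h2⟩, h3⟩
    refine ⟨⟨h1, ?_⟩, h3⟩
    by_contra h4
    exact h3 (Or.inr ((P.exc_nat s).2 (Or.inr (Or.inr (Or.inr (by omega))))))
  · rintro ⟨⟨h1, h2⟩, h3⟩
    exact ⟨⟨h1, by omega⟩, h3⟩

end

lemma iff_aux1 {β d C Q k : ℕ} (h1 : 0 < k → k ≤ β + 1 ∧ C + (k - 1) * Q ≤ d)
    (h2 : β < k ∨ d < C + k * Q) (a : ℕ) : a ≤ β ∧ C + a * Q ≤ d ↔ a < k := by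
  constructor
  · rintro ⟨h3, h4⟩
    by_contra h5
    have : k * Q ≤ a * Q := Nat.mul_le_mul_right _ (by omega)
    omega
  · intro h3
    obtain ⟨h4, h5⟩ := h1 (by omega)
    have : a * Q ≤ (k - 1) * Q := Nat.mul_le_mul_right _ (by omega)
    omega

lemma iff_aux2 {α d C Q k : ℕ} (h1 : 0 < k → k ≤ α ∧ C + k * Q ≤ d)
    (h2 : α ≤ k ∨ d < C + (k + 1) * Q) (a : ℕ) : a + 1 ≤ α ∧ C + (a + 1) * Q ≤ d ↔ a < k := by
  constructor
  · rintro ⟨h3, h4⟩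
    by_contra h5
    have : (k + 1) * Q ≤ (a + 1) * Q := Nat.mul_le_mul_right _ (by omega)
    omega
  · intro h3
    obtain ⟨h4, h5⟩ := h1 (by omega)
    have : (a + 1) * Q ≤ k * Q := Nat.mul_le_mul_right _ (by omega)
    omega

/-- dimension of BCH codes of length `n = (q^m+1)/λ`, `m = 2t+1 ≥ 5`,
`t` even, `2 ≤ λ < q+1`, `λ ∣ q+1`, expressed via `|C_1 ∪ ⋯ ∪ C_{δ-1}| = n - k`. -/
theorem stmt_10 (q lam t m n : ℕ) (hq : IsPrimePow q) (hodd : Odd q)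
    (hlam : 2 ≤ lam) (hlt : lam < q + 1) (hdvd : lam ∣ q + 1)
    (ht : Even t) (hm : m = 2 * t + 1) (hm5 : 5 ≤ m) (hn : n = (q ^ m + 1) / lam)
    (δ : ℕ) (hδ1 : 1 ≤ δ - 1)
    (hδ2 : ((δ : ℚ) - 1) ≤ (2 * (q : ℚ) ^ (t + 1) + 2 * q - 1) / (lam : ℚ))
    (ε : ℤ) (hε : ε = ⌈((δ : ℚ) - 1) * (1 - (q : ℚ)⁻¹)⌉)
    (υ : ℕ) (hυ : υ = (q - 2) / lam + q / lam)
    (A : ℕ) (hA : A = (q ^ (t + 1) + 1) / lam)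
    (κ : ℕ) (hκ : κ = 2 * A - (2 * q + 1) / lam)
    (τ : ℤ) (hτ : τ = ⌈((κ : ℚ) - 1) * (1 - (q : ℚ)⁻¹)⌉)
    (N : ℤ) (hN : N = ((Finset.Icc 1 (δ - 1)).biUnion (cycCoset q n)).card) :
    -- case (1)
    (2 ≤ δ → δ ≤ A - q / lam →
      N = (n : ℤ) - ((n : ℤ) - 2 * (m : ℤ) * ε)) ∧
    (A - q / lam < δ → δ ≤ A + (q - 2) / lam →
      N = (n : ℤ) - ((n : ℤ) - 2 * (m : ℤ) * ε
            + 2 * (m : ℤ) * ((δ : ℤ) - (A : ℤ) + ((q / lam : ℕ) : ℤ)))) ∧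
    (A + (q - 2) / lam < δ → δ ≤ A + 2 * (q ^ t - 1) / lam →
      N = (n : ℤ) - ((n : ℤ) - 2 * (m : ℤ) * (ε - (υ : ℤ) - 1))) ∧
    -- case (2)
    ((q - 3) / lam ≠ 0 → ∀ a : ℕ, a ≤ (q - 3) / lam - 1 →
      (A + 2 * (q ^ t - 1) / lam + a * q ^ t < δ → δ ≤ A + (a + 1) * q ^ t →
        N = (n : ℤ) - ((n : ℤ) - 2 * (m : ℤ) * (ε - (υ : ℤ) - 2 * (a : ℤ) - 2))) ∧
      (A + (a + 1) * q ^ t < δ → δ ≤ A + 2 * (q ^ t - 1) / lam + (a + 1) * q ^ t →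
        N = (n : ℤ) - ((n : ℤ) - 2 * (m : ℤ) * (ε - (υ : ℤ) - 2 * (a : ℤ) - 3)))) ∧
    -- case (3)(i)
    ((q - 1) / lam = (q - 3) / lam →
      (A + 2 * (q ^ t - 1) / lam + ((q - 3) / lam) * q ^ t < δ → δ ≤ κ →
        N = (n : ℤ) - ((n : ℤ)
              - 2 * (m : ℤ) * (ε - (υ : ℤ) - 2 * (((q - 1) / lam : ℕ) : ℤ) - 2))) ∧
      (κ < δ → (δ : ℚ) ≤ (2 * (q : ℚ) ^ (t + 1) + 2 * q - 1) / (lam : ℚ) + 1 →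
        N = (n : ℤ) - ((n : ℤ)
              - 2 * (m : ℤ) * (τ - (υ : ℤ) - 2 * (((q - 1) / lam : ℕ) : ℤ) - 2)))) ∧
    -- case (3)(ii)
    ((q - 1) / lam = (q - 3) / lam + 1 →
      (A + 2 * (q ^ t - 1) / lam + ((q - 3) / lam) * q ^ t < δ →
          δ ≤ A + ((q - 1) / lam) * q ^ t →
        N = (n : ℤ) - ((n : ℤ)
              - 2 * (m : ℤ) * (ε - (υ : ℤ) - 2 * (((q - 1) / lam : ℕ) : ℤ)))) ∧
      (A + ((q - 1) / lam) * q ^ t < δ → δ ≤ κ →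
        N = (n : ℤ) - ((n : ℤ)
              - 2 * (m : ℤ) * (ε - (υ : ℤ) - 2 * (((q - 1) / lam : ℕ) : ℤ) - 1))) ∧
      (κ < δ → (δ : ℚ) ≤ (2 * (q : ℚ) ^ (t + 1) + 2 * q - 1) / (lam : ℚ) + 1 →
        N = (n : ℤ) - ((n : ℤ)
              - 2 * (m : ℤ) * (τ - (υ : ℤ) - 2 * (((q - 1) / lam : ℕ) : ℤ) - 1)))) := by
  have hq3 : 3 ≤ q := by
    have := hq.one_lt
    obtain ⟨k, hk⟩ := hodd
    omega
  have hl0 : 0 < lam := by omega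
  subst hm
  obtain ⟨E, hE⟩ := hdvd
  have dE : lam ∣ q + 1 := ⟨E, hE⟩
  have hdn : lam ∣ q ^ (2 * t + 1) + 1 := by
    have h := Odd.nat_add_dvd_pow_add_pow q 1 (n := 2 * t + 1) ⟨t, rfl⟩
    rw [one_pow] at h
    exact dE.trans h
  have hdA : lam ∣ q ^ (t + 1) + 1 := by
    have h := Odd.nat_add_dvd_pow_add_pow q 1 (n := t + 1) ht.add_one
    rw [one_pow] at h
    exact dE.trans h
  have hdD : lam ∣ q ^ t - 1 := by
    obtain ⟨r, hr⟩ := ht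
    have h := Nat.sub_dvd_pow_sub_pow (q ^ 2) 1 r
    rw [one_pow, ← pow_mul, show 2 * r = t by omega] at h
    refine dE.trans (Dvd.dvd.trans ?_ h)
    have h2 := Nat.sq_sub_sq q 1
    rw [one_pow] at h2
    rw [h2]
    exact dvd_mul_right _ _
  obtain ⟨D, hD⟩ := hdD
  have hn' : lam * n = q ^ (2 * t + 1) + 1 := by rw [hn]; exact Nat.mul_div_cancel' hdn
  have hA' : lam * A = q ^ (t + 1) + 1 := by rw [hA]; exact Nat.mul_div_cancel' hdA
  have hB : 2 * (q ^ t - 1) / lam = 2 * D := by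
    rw [hD, show 2 * (lam * D) = lam * (2 * D) by ring, Nat.mul_div_cancel_left _ hl0]
  rw [hB]
  clear hn hA hB
  obtain ⟨Q, hQ⟩ : ∃ Q, Q = q ^ t := ⟨_, rfl⟩
  have hQ2 : q * q ≤ Q := by
    rw [hQ, ← sq]; exact Nat.pow_le_pow_right (by omega) (by omega)
  have hQ1 : q ^ (t + 1) = q * Q := by rw [hQ]; ring
  have hQ0 : q ^ (2 * t + 1) = q * Q ^ 2 := by rw [hQ]; ring
  rw [hQ1] at hA'
  rw [hQ0] at hn'
  rw [← hQ] at hD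
  have hδ2' : ((δ : ℚ) - 1) * lam ≤ 2 * (q * Q) + 2 * q - 1 := by
    rw [le_div_iff₀ (by exact_mod_cast hl0)] at hδ2
    have : (q : ℚ) ^ (t + 1) = q * Q := by exact_mod_cast hQ1
    rw [this] at hδ2; exact hδ2
  rw [← hQ]
  have hQ3 : 3 * q ≤ Q := by nlinarith
  have P : Par q lam Q n A D E t :=
    { q3 := by exact_mod_cast hq3
      l2 := by exact_mod_cast hlam
      hQ := by exact_mod_cast hQ
      hQ2 := by exact_mod_cast hQ2
      hE := by exact_mod_cast hE.symm
      hD := by zify [show 1 ≤ Q by omega] at hD; exact hD.symm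
      hA := by exact_mod_cast hA'
      hn := by exact_mod_cast hn' }
  have hδ : 2 ≤ δ := by omega
  have hbd : lam * (δ - 1) ≤ 2 * q * Q + 2 * q - 1 := by
    have h1 : lam * (δ - 1) + 1 ≤ 2 * q * Q + 2 * q := by
      have h2 : (lam : ℚ) * (((δ - 1 : ℕ) : ℚ)) + 1 ≤ 2 * q * Q + 2 * q := by
        rw [Nat.cast_sub (by omega)]; push_cast; linarith
      exact_mod_cast h2
    omega
  -- bounds on the various quotients
  have hβ : lam * ((q - 2) / lam) ≤ q - 2 := Nat.mul_div_le _ lam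
  have hα : lam * (q / lam) ≤ q := Nat.mul_div_le _ lam
  have hγ : lam * ((q - 3) / lam) ≤ q - 3 := Nat.mul_div_le _ lam
  have hh : lam * ((q - 1) / lam) ≤ q - 1 := Nat.mul_div_le _ lam
  have hγ' : q - 3 < lam * ((q - 3) / lam + 1) := Nat.lt_mul_div_succ _ hl0
  have hγβ : (q - 3) / lam ≤ (q - 2) / lam := Nat.div_le_div_right (by omega)
  have hβh : (q - 2) / lam ≤ (q - 1) / lam := Nat.div_le_div_right (by omega)
  have hhα : q / lam = (q - 1) / lam := by
    apply le_antisymm _ (Nat.div_le_div_right (by omega))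
    rw [Nat.le_div_iff_mul_le hl0]
    have h1 := P.lam_ne_q ((q / lam : ℕ) : ℤ)
    have h2 : lam * (q / lam) ≠ q := by exact_mod_cast h1
    rw [mul_comm]; omega
  have hκ0 : lam * ((2 * q + 1) / lam) ≤ 2 * q + 1 := Nat.mul_div_le _ lam
  have hκ1 : 2 * q + 1 < lam * ((2 * q + 1) / lam + 1) := Nat.lt_mul_div_succ _ hl0
  have hqQ : 3 * Q ≤ q * Q := Nat.mul_le_mul_right _ hq3
  have hK : ∀ y, lam * y + 2 * q ≤ 2 * (q * Q) + 1 → y ≤ κ := by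
    intro y hy
    have : lam * (y + (2 * q + 1) / lam) ≤ lam * (2 * A) := by
      rw [mul_add, show lam * (2 * A) = 2 * (lam * A) by ring]; omega
    have := Nat.le_of_mul_le_mul_left this hl0
    omega
  have hK' : ∀ y, 2 * (q * Q) ≤ lam * y + 1 → κ ≤ y := by
    intro y hy
    by_contra hlt
    have h1 : y + (2 * q + 1) / lam + 1 ≤ 2 * A := by omega
    have h2 : lam * (y + (2 * q + 1) / lam + 1) ≤ lam * (2 * A) := Nat.mul_le_mul_left _ h1
    rw [show lam * (2 * A) = 2 * (lam * A) by ring,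
      show lam * (y + (2 * q + 1) / lam + 1) = lam * y + lam * ((2 * q + 1) / lam + 1) by ring] at h2
    omega
  have hQD : lam * (2 * D) = 2 * (Q - 1) := by rw [hD]; ring
  have hβD : (q - 2) / lam < 2 * D := by
    by_contra h
    have : lam * (2 * D) ≤ lam * ((q - 2) / lam) := Nat.mul_le_mul_left _ (by omega)
    omega
  have hD0 : 0 < 2 * D := lt_of_le_of_lt (Nat.zero_le _) hβD
  have h2D : 2 * D < Q := by
    have : 2 * D ≤ lam * D := Nat.mul_le_mul_right _ hlam
    omega
  have hA1 : q / lam < A := by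
    by_contra h
    have h1 : lam * A ≤ lam * (q / lam) := Nat.mul_le_mul_left _ (by omega)
    have : q ≤ q * Q := Nat.le_mul_of_pos_right q (by omega)
    omega
  have hAK : A ≤ κ := hK _ (by omega)
  have tot : ∀ e k2 k3 : ℕ, δ ≤ κ →
      (∀ s, A - q / lam ≤ s → (s ≤ A + (q - 2) / lam ∧ s ≤ δ - 1 ↔ s ≤ e)) →
      (∀ a, a ≤ (q - 2) / lam ∧ A + 2 * D + a * Q ≤ δ - 1 ↔ a < k2) →
      (∀ a, a + 1 ≤ q / lam ∧ A + (a + 1) * Q ≤ δ - 1 ↔ a < k3) →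
      N = 2 * ((2 * t + 1 : ℕ) : ℤ) * (ε - (e + 1 - (A - q / lam) : ℕ) - k2 - k3) := by
    intro e k2 k3 h1 h2 h3 h4
    have := P.total (d := δ - 1) hbd (by omega) h2 h3 h4
    rw [Nat.cast_sub (by omega), Nat.cast_one, ← hε] at this
    rw [hN]; exact this
  have totκ : ∀ e k2 k3 : ℕ, κ < δ →
      (∀ s, A - q / lam ≤ s → (s ≤ A + (q - 2) / lam ∧ s ≤ κ - 1 ↔ s ≤ e)) →
      (∀ a, a ≤ (q - 2) / lam ∧ A + 2 * D + a * Q ≤ κ - 1 ↔ a < k2) →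
      (∀ a, a + 1 ≤ q / lam ∧ A + (a + 1) * Q ≤ κ - 1 ↔ a < k3) →
      N = 2 * ((2 * t + 1 : ℕ) : ℤ) * (τ - (e + 1 - (A - q / lam) : ℕ) - k2 - k3) := by
    intro e k2 k3 h1 h2 h3 h4
    have := P.total (d := κ - 1) (le_trans (Nat.mul_le_mul_left _ (by omega)) hbd) (by omega) h2 h3 h4
    rw [Nat.cast_sub (by omega), Nat.cast_one, ← hτ] at this
    rw [hN, P.stable hbd (by omega), ← hκ]; exact this
  -- abstract the quotients
  rw [← hhα]
  rw [← hhα] at hh hβh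
  have hlA : ∀ c : ℕ, lam * (A + c) = q * Q + 1 + lam * c := by
    intro c; rw [mul_add, hA']
  have hlAQ : ∀ c : ℕ, lam * (A + c * Q) = q * Q + 1 + lam * c * Q := by
    intro c; rw [mul_add, hA']; ring
  have hlBQ : ∀ c : ℕ, lam * (A + 2 * D + c * Q) = q * Q + 1 + 2 * (Q - 1) + lam * c * Q := by
    intro c; rw [mul_add, mul_add, hA', hQD]; ring
  have hκ' : κ - 1 + 1 = κ := by omega
  clear hhα hκ hκ0 hκ1 hδ2 hδ2' hε hτ hN hbd P
  generalize q / lam = α at *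
  generalize (q - 2) / lam = β at *
  generalize (q - 3) / lam = γ at *
  have hAβ : A + β ≤ κ := hK _ (by rw [hlA]; omega)
  have hA2D : A + 2 * D ≤ κ := hK _ (by rw [hlA, hQD]; omega)
  have hγQ : lam * γ * Q + 3 * Q ≤ q * Q := by
    rw [← add_mul]; exact Nat.mul_le_mul_right _ (by omega)
  have hBγ : A + 2 * D + γ * Q + 1 ≤ κ := by
    apply hK
    rw [mul_add, hlBQ]
    omega
  have hAα : A + α * Q + 1 ≤ κ := by
    apply hK
    rw [mul_add, hlAQ]
    have : lam * α * Q + Q ≤ q * Q := by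
      rw [← Nat.succ_mul]; exact Nat.mul_le_mul_right _ (by omega)
    omega
  have hBγ1 : γ + 1 ≤ β → κ ≤ A + 2 * D + (γ + 1) * Q := by
    intro h
    apply hK'
    rw [hlBQ]
    have : q * Q ≤ lam * (γ + 1) * Q + 2 * Q := by
      rw [← add_mul]; exact Nat.mul_le_mul_right _ (by omega)
    omega
  have hβγ : β ≤ γ + 1 := by
    by_contra h
    have : lam * (γ + 1 + 1) ≤ lam * β := Nat.mul_le_mul_left _ (by omega)
    have e : lam * (γ + 1 + 1) = lam * (γ + 1) + lam := by ring
    omega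
  refine ⟨?_, ?_, ?_, ?_, ?_, ?_⟩
  · intro _ h1
    rw [tot (A - α - 1) 0 0 (by omega) (fun s hs => by omega)
      (iff_aux1 (by omega) (Or.inr (by omega))) (iff_aux2 (by omega) (Or.inr (by omega))),
      show A - α - 1 + 1 - (A - α) = 0 by omega]
    push_cast; ring
  · intro h1 h2
    rw [tot (δ - 1) 0 0 (by omega) (fun s hs => by omega)
      (iff_aux1 (by omega) (Or.inr (by omega))) (iff_aux2 (by omega) (Or.inr (by omega))),
      show ((δ - 1 + 1 - (A - α) : ℕ) : ℤ) = δ - A + α by omega]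
    push_cast; ring
  · intro h1 h2
    rw [tot (A + β) 0 0 (by omega) (fun s hs => by omega)
      (iff_aux1 (by omega) (Or.inr (by omega))) (iff_aux2 (by omega) (Or.inr (by omega))),
      show ((A + β + 1 - (A - α) : ℕ) : ℤ) = υ + 1 by omega]
    push_cast; ring
  · intro h0 a ha
    have haγ : (a + 1) * Q ≤ γ * Q := Nat.mul_le_mul_right _ (by omega)
    have ea : (a + 1) * Q = a * Q + Q := by ring
    constructor
    · intro h1 h2
      rw [tot (A + β) (a + 1) a (by omega) (fun s hs => by omega)
        (iff_aux1 (fun _ => ⟨by omega, by simp only [Nat.add_sub_cancel]; omega⟩)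
          (Or.inr (by omega)))
        (iff_aux2 (fun _ => ⟨by omega, by omega⟩) (Or.inr (by omega))),
        show ((A + β + 1 - (A - α) : ℕ) : ℤ) = υ + 1 by omega]
      push_cast; ring
    · intro h1 h2
      have ea2 : (a + 1 + 1) * Q = (a + 1) * Q + Q := by ring
      rw [tot (A + β) (a + 1) (a + 1) (by omega) (fun s hs => by omega)
        (iff_aux1 (fun _ => ⟨by omega, by simp only [Nat.add_sub_cancel]; omega⟩)
          (Or.inr (by omega)))
        (iff_aux2 (fun _ => ⟨by omega, by omega⟩) (Or.inr (by omega))),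
        show ((A + β + 1 - (A - α) : ℕ) : ℤ) = υ + 1 by omega]
      push_cast; ring
  · intro h0
    subst h0
    constructor
    · intro h1 h2
      rw [tot (A + β) (α + 1) α (by omega) (fun s hs => by omega)
        (iff_aux1 (fun _ => ⟨by omega, by simp only [Nat.add_sub_cancel]; omega⟩)
          (Or.inl (by omega)))
        (iff_aux2 (fun _ => ⟨by omega, by omega⟩) (Or.inl (by omega))),
        show ((A + β + 1 - (A - α) : ℕ) : ℤ) = υ + 1 by omega]
      push_cast; ring
    · intro h1 _
      rw [totκ (A + β) (α + 1) α (by omega) (fun s hs => by omega)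
        (iff_aux1 (fun _ => ⟨by omega, by simp only [Nat.add_sub_cancel]; omega⟩)
          (Or.inl (by omega)))
        (iff_aux2 (fun _ => ⟨by omega, by omega⟩) (Or.inl (by omega))),
        show ((A + β + 1 - (A - α) : ℕ) : ℤ) = υ + 1 by omega]
      push_cast; ring
  · intro h0
    subst h0
    have ea : (γ + 1) * Q = γ * Q + Q := by ring
    refine ⟨?_, ?_, ?_⟩
    · intro h1 h2
      rw [tot (A + β) (γ + 1) γ (by omega) (fun s hs => by omega)
        (iff_aux1 (fun _ => ⟨by omega, by simp only [Nat.add_sub_cancel]; omega⟩)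
          (Or.inr (by omega)))
        (iff_aux2 (fun _ => ⟨by omega, by omega⟩) (Or.inr (by omega))),
        show ((A + β + 1 - (A - (γ + 1)) : ℕ) : ℤ) = υ + 1 by omega]
      push_cast; ring
    · intro h1 h2
      rw [tot (A + β) (γ + 1) (γ + 1) (by omega) (fun s hs => by omega)
        (iff_aux1 (fun _ => ⟨by omega, by simp only [Nat.add_sub_cancel]; omega⟩)
          (by by_cases hb : β < γ + 1
              · exact Or.inl hb
              · have := hBγ1 (by omega)
                exact Or.inr (by omega)))
        (iff_aux2 (fun _ => ⟨by omega, by omega⟩) (Or.inl (by omega))),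
        show ((A + β + 1 - (A - (γ + 1)) : ℕ) : ℤ) = υ + 1 by omega]
      push_cast; ring
    · intro h1 _
      rw [totκ (A + β) (γ + 1) (γ + 1) (by omega) (fun s hs => by omega)
        (iff_aux1 (fun _ => ⟨by omega, by simp only [Nat.add_sub_cancel]; omega⟩)
          (by by_cases hb : β < γ + 1
              · exact Or.inl hb
              · have := hBγ1 (by omega)
                exact Or.inr (by omega)))
        (iff_aux2 (fun _ => ⟨by omega, by omega⟩) (Or.inl (by omega))),
        show ((A + β + 1 - (A - (γ + 1)) : ℕ) : ℤ) = υ + 1 by omega]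
      push_cast; ring
end

section
/- Let q be a prime power with q ≡ 3 (mod 4), let m = 2t+1 ≥ 5, and let n = (q^m+1)/2. Then the first three largest coset leaders modulo n are δ_{1,n} = (q^m+1)/4, δ_{2,n} = (q^m-1)/4 - q^{m-1}/2 (i.e. (q^{m-1}(q-2) - 1)/4), and δ_{3,n} = δ_{2,n} - (q-1)/2. Moreover, the q-cyclotomic coset of δ_{1,n} modulo n has exactly 1 element, and the q-cyclotomic cosets of δ_{2,n} and of δ_{3,n} modulo n each have exactly 2m elements. -/
/-- Top three elements of a finset through the sorted list. -/
theorem aux_top3 (S : Finset ℕ) (a b c : ℕ) (ha : a ∈ S) (hb : b ∈ S) (hc : c ∈ S)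
    (hab : b < a) (hbc : c < b) (h : ∀ x ∈ S, x = a ∨ x = b ∨ x ≤ c) :
    ((S.sort (· ≤ ·)).reverse).getD 0 0 = a ∧ ((S.sort (· ≤ ·)).reverse).getD 1 0 = b ∧
    ((S.sort (· ≤ ·)).reverse).getD 2 0 = c := by
  have hp : ((S.sort (· ≤ ·)).reverse).Pairwise (fun x y => y < x) := by
    rw [List.pairwise_reverse]
    exact (Finset.sortedLT_sort S).pairwise
  have hmem : ∀ x, x ∈ (S.sort (· ≤ ·)).reverse ↔ x ∈ S := by
    intro x; simp
  generalize (S.sort (· ≤ ·)).reverse = L at hp hmem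
  rw [← hmem] at ha hb hc
  have h' : ∀ x ∈ L, x = a ∨ x = b ∨ x ≤ c := fun x hx => h x ((hmem x).1 hx)
  clear h hmem
  match L with
  | [] => simp at ha
  | [x] => simp at ha hb; omega
  | [x, y] => simp at ha hb hc; omega
  | x :: y :: w :: L =>
    simp only [List.pairwise_cons, List.mem_cons, forall_eq_or_imp] at hp ha hb hc h'
    obtain ⟨⟨h1, h2, h3⟩, ⟨h4, h5⟩, h6, -⟩ := hp
    obtain ⟨k1, k2, k3, -⟩ := h'
    have ea : x = a := by
      rcases ha with r | r | r | r
      · omega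
      · omega
      · omega
      · have := h3 a r; omega
    have eb : y = b := by
      rcases hb with r | r | r | r
      · omega
      · omega
      · omega
      · have := h5 b r; omega
    have ec : w = c := by
      rcases hc with r | r | r | r
      · omega
      · omega
      · omega
      · have := h6 c r; omega
    simp [ea, eb, ec]

/-- Parity obstruction. -/
theorem aux_parity (q Q N z : ℤ) (m : ℕ) (hq : Odd q) (hq3 : 3 ≤ q) (hN : N = q * Q + 1)
    (hm : q ^ m = N - 1) (hz : Even z) (hz0 : 0 < z) (hzQ : z < Q)
    (H : ∀ k : ℕ, ∃ w, N ∣ q ^ k * z - w ∧ |w| ≤ z) : False := by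
  have hNQ : 3 * Q + 1 ≤ N := by nlinarith
  have key : ∀ k : ℕ, ∃ A w, q ^ k * z = A * N + w ∧ |w| ≤ z ∧ w ≠ 0 ∧ (0 < w ↔ Even A) := by
    intro k
    induction k with
    | zero => exact ⟨0, z, by ring, by rw [abs_of_pos hz0], by omega, by simp [hz0]⟩
    | succ k ih =>
      obtain ⟨A, w, e, hw, hw0, hs⟩ := ih
      obtain ⟨w', ⟨A', e'⟩, hw'⟩ := H (k + 1)
      rw [abs_le] at hw hw'
      have e1 : (A' - q * A) * N = q * w - w' := by
        rw [pow_succ] at e'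
        linear_combination -e' + q * e
      obtain ⟨c, hc⟩ : ∃ c, c = A' - q * A := ⟨_, rfl⟩
      rw [← hc] at e1
      have hA' : A' = q * A + c := by omega
      have b1 : q * w ≤ q * (Q - 1) := by nlinarith
      have b2 : -(q * (Q - 1)) ≤ q * w := by nlinarith
      have c1 : c < 2 := by
        by_contra hcc
        have : 2 * N ≤ c * N := by nlinarith
        nlinarith
      have c2 : -2 < c := by
        by_contra hcc
        have : c * N ≤ -2 * N := by nlinarith
        nlinarith
      refine ⟨A', w', by linear_combination e', by rw [abs_le]; exact hw', ?_⟩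
      have hpar : Even (q * A) ↔ Even A := by
        rw [Int.even_mul]
        have := Int.not_even_iff_odd.2 hq
        tauto
      have hc3 : c = -1 ∨ c = 0 ∨ c = 1 := by omega
      rcases hc3 with rfl | rfl | rfl
      · have p1 : 0 < w' := by nlinarith
        have p2 : w < 0 := by nlinarith
        refine ⟨by omega, ?_⟩
        rw [hA', Int.even_add, hpar, ← hs]
        simp [p1]; omega
      · have p1 : w' = q * w := by linarith
        have p2 : 0 < w' ↔ 0 < w := by
          rw [p1]; constructor
          · intro h; nlinarith
          · intro h; positivity
        refine ⟨by rw [p1]; exact mul_ne_zero (by omega) hw0, ?_⟩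
        rw [hA', Int.even_add, hpar, ← hs, p2]
        simp
      · have p1 : w' < 0 := by nlinarith
        have p2 : 0 < w := by nlinarith
        refine ⟨by omega, ?_⟩
        rw [hA', Int.even_add, hpar, ← hs]
        simp [p2]; omega
  obtain ⟨A, w, e, hw, hw0, hs⟩ := key m
  rw [hm] at e
  rw [abs_le] at hw
  have e1 : (z - A) * N = z + w := by linear_combination e
  have e2 : z - A = 0 := by
    by_contra hne
    rcases lt_or_gt_of_ne hne with h | h
    · nlinarith
    · nlinarith
  have e3 : w = -z := by rw [e2] at e1; linarith
  have : A = z := by omega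
  rw [this] at hs
  have := hs.2 hz
  omega

/-- Membership in a coset when the order is finite. -/
theorem aux_mem (q n s d : ℕ) (hd : 0 < d) (h1 : (q : ZMod n) ^ d = 1) (x : ℕ) :
    x ∈ cycCoset q n s ↔ ∃ k : ℕ, x = s * q ^ k % n := by
  unfold cycCoset
  simp only [Finset.mem_image, Finset.mem_range]
  constructor
  · rintro ⟨k, -, rfl⟩; exact ⟨k, rfl⟩
  · rintro ⟨k, rfl⟩
    have hpos : 0 < orderOf (q : ZMod n) :=
      orderOf_pos_iff.2 (isOfFinOrder_iff_pow_eq_one.2 ⟨d, hd, h1⟩)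
    refine ⟨k % orderOf (q : ZMod n), Nat.mod_lt _ hpos, ?_⟩
    have : ((s * q ^ (k % orderOf (q : ZMod n)) : ℕ) : ZMod n) = ((s * q ^ k : ℕ) : ZMod n) := by
      push_cast
      rw [pow_mod_orderOf]
    exact (ZMod.natCast_eq_natCast_iff' _ _ _).1 this

/-- Centered coordinate of an element of the coset. -/
theorem aux_center (q n s k : ℕ) (hq : q % 2 = 1) :
    (2 * n : ℤ) ∣ (q : ℤ) ^ k * (n - 2 * s) - (n - 2 * ((s * q ^ k % n : ℕ) : ℤ)) := by
  have h1 : (2 : ℤ) ∣ (q : ℤ) ^ k - 1 := by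
    have : Odd ((q : ℤ) ^ k) := by
      apply Odd.pow
      exact_mod_cast Nat.odd_iff.2 hq
    obtain ⟨r, hr⟩ := this
    exact ⟨r, by omega⟩
  obtain ⟨r, hr⟩ := h1
  have h2 : ((s * q ^ k % n : ℕ) : ℤ) = s * q ^ k - n * ((s * q ^ k / n : ℕ) : ℤ) := by
    have := Nat.mod_add_div (s * q ^ k) n
    have h3 : ((s * q ^ k % n : ℕ) : ℤ) + n * ((s * q ^ k / n : ℕ) : ℤ) = s * q ^ k := by
      exact_mod_cast this
    linarith
  refine ⟨r - ((s * q ^ k / n : ℕ) : ℤ), ?_⟩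
  rw [h2]
  linear_combination (n : ℤ) * hr

theorem aux_uniq (n a b : ℤ) (h : 2 * n ∣ a - b) (ha : -n < a) (ha' : a ≤ n)
    (hb : -n < b) (hb' : b ≤ n) : a = b := by
  have : a - b = 0 := by
    apply Int.eq_zero_of_abs_lt_dvd h
    rw [abs_lt]; constructor <;> omega
  omega

theorem aux_range (q n s k : ℕ) (hn : 0 < n) :
    -(n : ℤ) < n - 2 * ((s * q ^ k % n : ℕ) : ℤ) ∧ (n : ℤ) - 2 * ((s * q ^ k % n : ℕ) : ℤ) ≤ n := by
  have := Nat.mod_lt (s * q ^ k) hn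
  constructor <;> omega

/-- Leaders in centered coordinates. -/
theorem aux_leader (q n s d : ℕ) (hn : 0 < n) (hd : 0 < d) (h1 : (q : ZMod n) ^ d = 1)
    (hq : q % 2 = 1) :
    s ∈ cosetLeaders q n ↔ s < n ∧ ∀ (k : ℕ) (w : ℤ), 2 * (n : ℤ) ∣ (q : ℤ) ^ k * (n - 2 * s) - w →
      -(n : ℤ) < w → w ≤ n → w ≤ n - 2 * s := by
  unfold cosetLeaders
  simp only [Finset.mem_filter, Finset.mem_range, aux_mem q n s d hd h1]
  constructor
  · rintro ⟨hs, -, h⟩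
    refine ⟨hs, fun k w hw w1 w2 => ?_⟩
    have h2 := h _ ⟨k, rfl⟩
    have hc := aux_center q n s k hq
    have hr := aux_range q n s k hn
    have hd := dvd_sub hw hc
    rw [sub_sub_sub_cancel_left] at hd
    have := aux_uniq n _ w hd hr.1 hr.2 w1 w2
    omega
  · rintro ⟨hs, h⟩
    refine ⟨hs, ⟨0, by simp [Nat.mod_eq_of_lt hs]⟩, ?_⟩
    rintro x ⟨k, rfl⟩
    have hr := aux_range q n s k hn
    have := h k _ (aux_center q n s k hq) hr.1 hr.2
    omega

/-- Coset cardinality from the absence of small periods. -/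
theorem aux_card (q n s d : ℕ) (hn : 0 < n) (hd : 0 < d) (h1 : (q : ZMod n) ^ d = 1)
    (hq : q % 2 = 1)
    (h : ∀ e, 0 < e → e < d → ¬ (2 * (n : ℤ) ∣ (q : ℤ) ^ e * (n - 2 * s) - (n - 2 * s))) :
    (cycCoset q n s).card = d := by
  have hne : ∀ e, 0 < e → e < d → (s : ZMod n) * (q : ZMod n) ^ e ≠ s := by
    intro e he he' heq
    have h2 : ((s * q ^ e : ℕ) : ZMod n) = (s : ℕ) := by push_cast; exact heq
    have h3 := (ZMod.natCast_eq_natCast_iff' _ _ _).1 h2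
    have hc := aux_center q n s e hq
    rw [h3] at hc
    have h5 : ((s % n : ℕ) : ℤ) = s - n * ((s / n : ℕ) : ℤ) := by
      have := Nat.mod_add_div s n
      have h3 : ((s % n : ℕ) : ℤ) + n * ((s / n : ℕ) : ℤ) = s := by exact_mod_cast this
      linarith
    apply h e he he'
    obtain ⟨r, hr⟩ := hc
    refine ⟨r + ((s / n : ℕ) : ℤ), ?_⟩
    rw [h5] at hr
    linear_combination hr
  have hpos : 0 < orderOf (q : ZMod n) :=
    orderOf_pos_iff.2 (isOfFinOrder_iff_pow_eq_one.2 ⟨d, hd, h1⟩)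
  have hord : orderOf (q : ZMod n) = d := by
    have hle := Nat.le_of_dvd hd (orderOf_dvd_of_pow_eq_one h1)
    by_contra hcon
    apply hne (orderOf (q : ZMod n)) hpos (by omega)
    rw [pow_orderOf_eq_one, mul_one]
  have hunit : IsUnit (q : ZMod n) := IsUnit.of_pow_eq_one h1 (by omega)
  have aux : ∀ i j, i < j → j < d → s * q ^ i % n ≠ s * q ^ j % n := by
    intro i j hij hj heq
    have h2 := (ZMod.natCast_eq_natCast_iff' _ _ _).2 heq
    push_cast at h2
    apply hne (j - i) (by omega) (by omega)
    apply (hunit.pow i).mul_right_cancel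
    rw [h2, mul_assoc, ← pow_add]
    congr 2; omega
  unfold cycCoset
  rw [Finset.card_image_of_injOn, Finset.card_range, hord]
  intro i hi j hj hij
  simp only [Finset.coe_range, Set.mem_Iio, hord] at hi hj
  by_contra hne2
  rcases lt_or_gt_of_ne hne2 with hl | hl
  · exact aux i j hl hj hij
  · exact aux j i hl hi hij.symm

/-- A centered value with strictly smaller iterates gives a leader with full coset. -/
theorem aux_good (q n s m : ℕ) (hn : 0 < n) (hm : 0 < m) (h1 : (q : ZMod n) ^ (2 * m) = 1)
    (hq : q % 2 = 1) (hN : (q : ℤ) ^ m + 1 = 2 * n) (z : ℤ) (hz : z = n - 2 * s) (hz0 : 0 < z)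
    (hzn : z < n)
    (H : ∀ e, 0 < e → e < m → ∃ v : ℤ, 2 * (n : ℤ) ∣ (q : ℤ) ^ e * z - v ∧ |v| < z) :
    s ∈ cosetLeaders q n ∧ (cycCoset q n s).card = 2 * m := by
  have hall : ∀ k : ℕ, ∃ v : ℤ, 2 * (n : ℤ) ∣ (q : ℤ) ^ k * z - v ∧ |v| ≤ z := by
    intro k
    induction k using Nat.strong_induction_on with
    | _ k ih =>
      rcases Nat.eq_zero_or_pos k with rfl | hk
      · exact ⟨z, by simp, by rw [abs_of_pos hz0]⟩
      rcases lt_or_ge k m with hkm | hkm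
      · obtain ⟨v, h2, h3⟩ := H k hk hkm
        exact ⟨v, h2, h3.le⟩
      · obtain ⟨v, ⟨r, hr⟩, h3⟩ := ih (k - m) (by omega)
        refine ⟨-v, ⟨(q : ℤ) ^ (k - m) * z - r, ?_⟩, by rwa [abs_neg]⟩
        have : (q : ℤ) ^ k = q ^ m * q ^ (k - m) := by rw [← pow_add]; congr 1; omega
        rw [this]
        linear_combination (q : ℤ) ^ (k - m) * z * hN - hr
  constructor
  · rw [aux_leader q n s (2 * m) hn (by omega) h1 hq]
    refine ⟨by omega, fun k w hw w1 w2 => ?_⟩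
    rw [← hz] at hw ⊢
    obtain ⟨v, h2, h3⟩ := hall k
    rw [abs_le] at h3
    have h4 := dvd_sub hw h2
    rw [sub_sub_sub_cancel_left] at h4
    have := aux_uniq n v w h4 (by omega) (by omega) w1 w2
    omega
  · apply aux_card q n s (2 * m) hn (by omega) h1 hq
    intro e he he2 hdvd
    rw [← hz] at hdvd
    rcases lt_trichotomy e m with hl | rfl | hl
    · obtain ⟨v, h2, h3⟩ := H e he hl
      rw [abs_lt] at h3
      have h4 := dvd_sub hdvd h2
      rw [sub_sub_sub_cancel_left] at h4
      have := aux_uniq n v z h4 (by omega) (by omega) (by omega) (by omega)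
      omega
    · have h4 : 2 * (n : ℤ) ∣ z - (-z) := by
        obtain ⟨r, hr⟩ := hdvd
        exact ⟨z - r, by linear_combination z * hN - hr⟩
      have := aux_uniq n _ _ h4 (by omega) (by omega) (by omega) (by omega)
      omega
    · obtain ⟨v, ⟨r', hr'⟩, h3⟩ := H (e - m) (by omega) (by omega)
      rw [abs_lt] at h3
      have h4 : 2 * (n : ℤ) ∣ z - (-v) := by
        obtain ⟨r, hr⟩ := hdvd
        refine ⟨(q : ℤ) ^ (e - m) * z - r - r', ?_⟩
        have : (q : ℤ) ^ e = q ^ m * q ^ (e - m) := by rw [← pow_add]; congr 1; omega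
        rw [this] at hr
        linear_combination (q : ℤ) ^ (e - m) * z * hN - hr - hr'
      have := aux_uniq n _ _ h4 (by omega) (by omega) (by omega) (by omega)
      omega

set_option maxHeartbeats 2000000 in
/-- Classification of the small centered values of leaders. -/
theorem aux_class (q n s m R : ℕ) (hn : 0 < n) (hm : 3 ≤ m) (h1 : (q : ZMod n) ^ (2 * m) = 1)
    (hq : q % 2 = 1) (hq3 : 3 ≤ q) (hR : R = q ^ (m - 3)) (hR3 : 3 ≤ R) (hN : (q : ℤ) ^ m + 1 = 2 * n)
    (hne : n % 2 = 0) (hs : s ∈ cosetLeaders q n) :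
    (n : ℤ) - 2 * s = 0 ∨ (n : ℤ) - 2 * s = q * (q * R) + 1 ∨ (q : ℤ) * (q * R) + q ≤ n - 2 * s := by
  rw [aux_leader q n s (2 * m) hn (by omega) h1 hq] at hs
  obtain ⟨hs, H⟩ := hs
  obtain ⟨z, hz⟩ : ∃ z : ℤ, z = n - 2 * s := ⟨_, rfl⟩
  obtain ⟨Q, hQ⟩ : ∃ Q : ℤ, Q = q * (q * R) := ⟨_, rfl⟩
  have hRz : (R : ℤ) = (q : ℤ) ^ (m - 3) := by exact_mod_cast hR
  have hqm : (q : ℤ) ^ m = q * Q := by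
    rw [hQ, hRz]
    have : m = (m - 3) + 3 := by omega
    conv_lhs => rw [this]
    ring
  have hNQ : 2 * (n : ℤ) = q * Q + 1 := by rw [← hN, hqm]
  have hq3' : (3 : ℤ) ≤ q := by exact_mod_cast hq3
  have hR3' : (3 : ℤ) ≤ R := by exact_mod_cast hR3
  have hqQ : 3 * (q : ℤ) ≤ Q := by
    have h9 : (3 : ℤ) ≤ q * R := by nlinarith
    rw [hQ]; nlinarith
  have hqR : 3 * ((q : ℤ) * R) ≤ Q := by rw [hQ]; nlinarith
  rw [← hQ, ← hz]
  rw [← hz] at H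
  have hzz : Even z := by
    rw [Int.even_iff]; omega
  have hzodd : z % 2 = 0 := Int.even_iff.1 hzz
  have hqodd : Odd (q : ℤ) := by exact_mod_cast Nat.odd_iff.2 hq
  have hQodd : Odd Q := by
    have h5 : Odd ((q : ℤ) ^ m) := hqodd.pow
    rw [hqm] at h5
    exact (Int.odd_mul.1 h5).2
  have hQo : Q % 2 = 1 := Int.odd_iff.1 hQodd
  have hqo : (q : ℤ) % 2 = 1 := Int.odd_iff.1 hqodd
  by_contra hcon
  push Not at hcon
  obtain ⟨g1, g2, g3⟩ := hcon
  have hQn : 3 * Q + 1 ≤ 2 * n := by rw [hNQ]; nlinarith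
  have hzn : z < n := by omega
  have hall : ∀ k : ℕ, ∃ w : ℤ, 2 * (n : ℤ) ∣ (q : ℤ) ^ k * z - w ∧ |w| ≤ z := by
    intro k
    have hc := aux_center q n s k hq
    have hr := aux_range q n s k hn
    rw [← hz] at hc
    refine ⟨_, hc, ?_⟩
    have u1 := H k _ hc hr.1 hr.2
    rw [abs_le]
    refine ⟨?_, u1⟩
    have u2 := H (k + m) (-((n : ℤ) - 2 * ((s * q ^ k % n : ℕ) : ℤ))) ?_ (by omega) (by omega)
    · omega
    · obtain ⟨r, hr⟩ := hc
      refine ⟨(q : ℤ) ^ k * z - r, ?_⟩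
      rw [pow_add]
      linear_combination (q : ℤ) ^ k * z * hN - hr
  have hz0 : 0 < z := by
    obtain ⟨w, -, hw⟩ := hall 0
    have := abs_nonneg w
    omega
  rcases lt_or_ge z Q with hlt | hge
  · exact aux_parity q Q (2 * n) z m hqodd hq3' hNQ (by linarith) hzz hz0 hlt hall
  · obtain ⟨a, ha⟩ : ∃ a, a = z - Q := ⟨_, rfl⟩
    have a1 : 3 ≤ a := by omega
    have a2 : a ≤ q - 2 := by omega
    obtain ⟨w, ⟨r, hr⟩, hw⟩ := hall (m - 1)
    rw [abs_le] at hw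
    have hq1 : (q : ℤ) ^ (m - 1) = Q := by
      rw [hQ, hRz]
      have : m - 1 = (m - 3) + 2 := by omega
      rw [this]; ring
    rw [hq1] at hr
    have hP : Q = q * ((q : ℤ) * R) := hQ
    obtain ⟨P, hPd⟩ : ∃ P : ℤ, P = (q : ℤ) * R := ⟨_, rfl⟩
    rw [← hPd] at hP hqR
    -- `Q * z ≡ a * Q - P`
    have e1 : (r - P) * (2 * n) = a * Q - P - w := by
      have hzQ : z = Q + a := by omega
      rw [hzQ] at hr
      linear_combination -hr - P * hNQ + Q * hP
    have b1 : 3 * Q ≤ a * Q := by nlinarith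
    have b2 : a * Q ≤ (q - 2) * Q := by nlinarith
    have hPpos : 0 < P := by rw [hPd]; nlinarith
    have c1 : 0 < r - P := by
      by_contra hh
      have : (r - P) * (2 * n) ≤ 0 :=
        mul_nonpos_of_nonpos_of_nonneg (by omega) (by positivity)
      omega
    have c2 : 2 * (n : ℤ) ≤ (r - P) * (2 * n) :=
      le_mul_of_one_le_left (by positivity) (by omega)
    have b3 : ((q : ℤ) - 2) * Q = 2 * n - 1 - 2 * Q := by rw [hNQ]; ring
    omega

set_option maxHeartbeats 4000000 in
/-- for a prime power `q ≡ 3 (mod 4)`, `m = 2t+1 ≥ 5`, `n = (q^m+1)/2`,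
the first three largest coset leaders modulo `n` and their coset sizes. -/
theorem stmt_13 (q t m n : ℕ) (hq : IsPrimePow q) (hq4 : q % 4 = 3)
    (hm : m = 2 * t + 1) (hm5 : 5 ≤ m) (hn : n = (q ^ m + 1) / 2) :
    nthLargestCosetLeader q n 1 = (q ^ m + 1) / 4 ∧
    nthLargestCosetLeader q n 2 = (q ^ (m - 1) * (q - 2) - 1) / 4 ∧
    nthLargestCosetLeader q n 3 = (q ^ (m - 1) * (q - 2) - 1) / 4 - (q - 1) / 2 ∧
    (cycCoset q n ((q ^ m + 1) / 4)).card = 1 ∧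
    (cycCoset q n ((q ^ (m - 1) * (q - 2) - 1) / 4)).card = 2 * m ∧
    (cycCoset q n ((q ^ (m - 1) * (q - 2) - 1) / 4 - (q - 1) / 2)).card = 2 * m := by
  have hq3 : 3 ≤ q := by omega
  have hq2 : q % 2 = 1 := by omega
  obtain ⟨R, hR⟩ : ∃ R, R = q ^ (m - 3) := ⟨_, rfl⟩
  have hR3 : 3 ≤ R := by
    rw [hR]
    calc 3 ≤ q := hq3
      _ = q ^ 1 := (pow_one q).symm
      _ ≤ q ^ (m - 3) := Nat.pow_le_pow_right (by omega) (by omega)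
  obtain ⟨P, hP⟩ : ∃ P, P = q * R := ⟨_, rfl⟩
  obtain ⟨Q, hQ⟩ : ∃ Q, Q = q * P := ⟨_, rfl⟩
  have hPp : q ^ (m - 2) = P := by
    rw [hP, hR, ← pow_succ']; congr 1; omega
  have hQp : q ^ (m - 1) = Q := by
    rw [hQ, ← hPp, ← pow_succ']; congr 1; omega
  have hmp : q ^ m = q * Q := by
    rw [← hQp, ← pow_succ']; congr 1; omega
  have hQ4 : Q % 4 = 1 := by
    rw [← hQp, hm, show 2 * t + 1 - 1 = 2 * t by omega, pow_mul, Nat.pow_mod]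
    have : q ^ 2 % 4 = 1 := by rw [Nat.pow_mod, hq4]
    rw [this]; simp
  have hqQ4 : (q * Q) % 4 = 3 := by rw [Nat.mul_mod, hq4, hQ4]
  have hqQ3 : 3 * q ≤ Q := by
    have h9 : 3 ≤ q * R := by nlinarith
    rw [hQ, hP]; nlinarith
  have hmulQ : 3 * Q ≤ q * Q := Nat.mul_le_mul_right Q hq3
  have hsub : Q * (q - 2) + 2 * Q = q * Q := by
    obtain ⟨c, rfl⟩ : ∃ c, q = c + 2 := ⟨q - 2, by omega⟩
    simp only [Nat.add_sub_cancel]; ring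
  rw [hmp] at hn
  rw [hmp, hQp]
  obtain ⟨a, ha⟩ : ∃ a, a = (q * Q + 1) / 4 := ⟨_, rfl⟩
  obtain ⟨b, hb⟩ : ∃ b, b = (Q * (q - 2) - 1) / 4 := ⟨_, rfl⟩
  obtain ⟨c, hc⟩ : ∃ c, c = b - (q - 1) / 2 := ⟨_, rfl⟩
  rw [← ha, ← hb, ← hc]
  have hbig : q * Q + 1 = 2 * n := by omega
  have hn0 : 0 < n := by omega
  have za : (n : ℤ) - 2 * a = 0 := by omega
  have zb : (Q : ℤ) + 1 = n - 2 * b := by omega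
  have hcb : (q - 1) / 2 < b := by omega
  have zc : (Q : ℤ) + q = n - 2 * c := by omega
  have hNz : (q : ℤ) ^ m + 1 = 2 * n := by
    have : q ^ m + 1 = 2 * n := by rw [hmp, hbig]
    exact_mod_cast this
  have h1 : (q : ZMod n) ^ (2 * m) = 1 := by
    have h2 : ((q ^ m + 1 : ℕ) : ZMod n) = 0 := by
      rw [hmp, hbig]; push_cast; simp
    push_cast at h2
    have h3 : (q : ZMod n) ^ m = -1 := eq_neg_of_add_eq_zero_left h2
    rw [mul_comm, pow_mul, h3]; simp
  have iQ : (Q : ℤ) = q * P := by exact_mod_cast hQ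
  have iP : (P : ℤ) = q * R := by exact_mod_cast hP
  have iN : (q : ℤ) * Q + 1 = 2 * n := by exact_mod_cast hbig
  have hq3' : (3 : ℤ) ≤ q := by exact_mod_cast hq3
  have hb' := aux_good q n b m hn0 (by omega) h1 hq2 hNz _ zb (by omega) (by omega) (by
    intro e he hem
    obtain ⟨f, rfl⟩ : ∃ f, e = f + 1 := ⟨e - 1, by omega⟩
    refine ⟨(q : ℤ) ^ f * (q - 1), ⟨(q : ℤ) ^ f, ?_⟩, ?_⟩
    · rw [pow_succ]
      linear_combination (q : ℤ) ^ f * iN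
    · have hle : (q : ℤ) ^ f ≤ P := by
        rw [← hPp]
        exact_mod_cast Nat.pow_le_pow_right (by omega) (by omega)
      have hpos : (0 : ℤ) < (q : ℤ) ^ f := by positivity
      rw [abs_of_nonneg (by nlinarith)]
      nlinarith)
  have hc' := aux_good q n c m hn0 (by omega) h1 hq2 hNz _ zc (by omega) (by omega) (by
    intro e he hem
    obtain ⟨f, rfl⟩ : ∃ f, e = f + 1 := ⟨e - 1, by omega⟩
    rcases Nat.lt_or_ge f (m - 2) with hf | hf
    · refine ⟨(q : ℤ) ^ f * (q ^ 2 - 1), ⟨(q : ℤ) ^ f, ?_⟩, ?_⟩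
      · rw [pow_succ]
        linear_combination (q : ℤ) ^ f * iN
      · have hle : (q : ℤ) ^ f ≤ R := by
          rw [hR]
          exact_mod_cast Nat.pow_le_pow_right (by omega) (by omega)
        have hpos : (0 : ℤ) < (q : ℤ) ^ f := by positivity
        have hq1 : (0 : ℤ) < (q : ℤ) ^ 2 - 1 := by nlinarith
        rw [abs_of_nonneg (by positivity)]
        have h5 : (q : ℤ) ^ f * (q ^ 2 - 1) ≤ R * (q ^ 2 - 1) :=
          mul_le_mul_of_nonneg_right hle hq1.le
        have h6 : (Q : ℤ) = R * q ^ 2 := by rw [iQ, iP]; ring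
        nlinarith
    · have hff : f + 1 = m - 1 := by omega
      rw [hff]
      have hQz : (q : ℤ) ^ (m - 1) = Q := by exact_mod_cast hQp
      rw [hQz]
      refine ⟨-(1 + P), ⟨P + 1, ?_⟩, ?_⟩
      · linear_combination (P + 1 : ℤ) * iN + (Q : ℤ) * iQ
      · rw [abs_neg, abs_of_nonneg (by positivity)]
        nlinarith)
  have ha1 : ∀ k, a * q ^ k % n = a := by
    intro k
    have hcc := aux_center q n a k hq2
    have hr := aux_range q n a k hn0
    rw [za, mul_zero, ← za] at hcc
    have := aux_uniq n _ _ hcc (by omega) (by omega) hr.1 hr.2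
    omega
  have ha' : a ∈ cosetLeaders q n := by
    rw [aux_leader q n a (2 * m) hn0 (by omega) h1 hq2]
    refine ⟨by omega, fun k w hw w1 w2 => ?_⟩
    rw [za, mul_zero] at hw
    have := aux_uniq n 0 w hw (by omega) (by omega) w1 w2
    omega
  have top := aux_top3 (cosetLeaders q n) a b c ha' hb'.1 hc'.1 (by omega) (by omega) (by
    intro x hx
    have := aux_class q n x m R hn0 (by omega) h1 hq2 hq3 hR hR3 hNz (by omega) hx
    rw [← iP, ← iQ] at this
    omega)
  refine ⟨top.1, top.2.1, top.2.2, ?_, hb'.2, hc'.2⟩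
  have : cycCoset q n a = {a} := by
    ext x
    rw [aux_mem q n a (2 * m) (by omega) h1]
    simp [ha1]
  rw [this]; simp
end

section
/- Let q be an odd prime power with q ≥ 5, m = 2t+1 ≥ 5, and n = (q^m+1)/(q+1). Set A = (q^{t+1}+2q^t+1)/(q+1) and B = 2(q^{t+1}-1)/(q+1) - 1 if t is odd, and A = (q^{t+1}+2q^t-1)/(q+1) and B = 2(q^{t+1}+1)/(q+1) - 1 if t is even; for an integer δ set ε = ⌈(δ-1)(1-q^{-1})⌉. Then the union C_1 ∪ ... ∪ C_{δ-1} of q-cyclotomic cosets modulo n has cardinality n - k (equivalently, the BCH code C_{(n,q,δ,1)} has dimension k and C_{(n,q,δ+1,0)} has dimension k-1), where k = n - 2m(ε - 1) if q^t + 2 ≤ δ ≤ A, and k = n - 2m(ε - 2) if A + 1 ≤ δ ≤ B. -/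
namespace BCHAux

/-- numerical set-up: `P = q^t`, `s = ±1`, `E (q+1) = P + s`, `D = P - E`, `n = D P + s E`. -/
structure Setup (q t n : ℕ) (P s E : ℤ) : Prop where
  hq : 5 ≤ q
  ht : 2 ≤ t
  hP : P = (q : ℤ) ^ t
  hs : s = 1 ∨ s = -1
  hE : E * ((q : ℤ) + 1) = P + s
  hn : (n : ℤ) = (P - E) * P + s * E

variable {q t n : ℕ} {P s E : ℤ}

theorem Setup.P25 (h : Setup q t n P s E) : 25 ≤ P := by
  rw [h.hP]
  have hq : (5 : ℤ) ≤ q := by exact_mod_cast h.hq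
  calc (25 : ℤ) = 5 ^ 2 := by norm_num
    _ ≤ (q : ℤ) ^ 2 := by gcongr
    _ ≤ (q : ℤ) ^ t := by
      apply pow_le_pow_right₀ (by linarith) h.ht

theorem Setup.Ebd (h : Setup q t n P s E) : 1 ≤ E ∧ 6 * E ≤ P + 1 := by
  have hq : (5 : ℤ) ≤ q := by exact_mod_cast h.hq
  have hP := h.P25
  have hE := h.hE
  have hs : -1 ≤ s ∧ s ≤ 1 := by rcases h.hs with h | h <;> omega
  have h1 : 1 ≤ E := by
    by_contra hc
    have : E ≤ 0 := by omega
    nlinarith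
  refine ⟨h1, by nlinarith⟩

theorem Setup.qP (h : Setup q t n P s E) : ∃ Q : ℤ, P = q * Q ∧ Q = (q : ℤ) ^ (t - 1) ∧ 5 ≤ Q := by
  have hq : (5 : ℤ) ≤ q := by exact_mod_cast h.hq
  refine ⟨(q : ℤ) ^ (t - 1), ?_, rfl, ?_⟩
  · rw [h.hP, ← pow_succ']
    congr 1
    have := h.ht
    omega
  · calc (5 : ℤ) ≤ (q : ℤ) ^ 1 := by simpa using hq
      _ ≤ _ := pow_le_pow_right₀ (by linarith) (by have := h.ht; omega)

/-- `q ∣ E - s`. -/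
theorem Setup.qE (h : Setup q t n P s E) : (q : ℤ) ∣ E - s := by
  obtain ⟨Q, hQ, -, -⟩ := h.qP
  exact ⟨Q - E, by have := h.hE; rw [hQ] at this; linear_combination this⟩

theorem not_dvd_s (hq : 5 ≤ q) (hs : s = 1 ∨ s = -1) : ¬ (q : ℤ) ∣ s := by
  have hq : (5 : ℤ) ≤ q := by exact_mod_cast hq
  intro hd
  have h1 : (q : ℤ) ∣ 1 := by
    rcases hs with h | h
    · rwa [h] at hd
    · rw [h] at hd; exact (dvd_neg.mp hd)
  have := Int.le_of_dvd (by norm_num) h1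
  omega

theorem Setup.E_nd (h : Setup q t n P s E) : ¬ (q : ℤ) ∣ E := fun hd =>
  not_dvd_s h.hq h.hs (by have := dvd_sub hd h.qE; simpa using this)

theorem Setup.D_nd (h : Setup q t n P s E) : ¬ (q : ℤ) ∣ P - E := fun hd => by
  obtain ⟨Q, hQ, -, -⟩ := h.qP
  refine h.E_nd ?_
  have := dvd_sub (Dvd.intro Q hQ.symm : (q : ℤ) ∣ P) hd
  simpa using this

theorem Setup.A_nd (h : Setup q t n P s E) : ¬ (q : ℤ) ∣ P + E := fun hd => by
  obtain ⟨Q, hQ, -, -⟩ := h.qP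
  refine h.E_nd ?_
  have := dvd_sub hd (Dvd.intro Q hQ.symm : (q : ℤ) ∣ P)
  simpa using this

/-- Core step, `j = t`. -/
theorem Setup.core_t (h : Setup q t n P s E) (a c : ℤ) (ha : 1 ≤ a) (ha' : a ≤ 2 * (P - E) - 2)
    (hc : |c| ≤ 2 * (P - E) - 2) (hqa : ¬ (q : ℤ) ∣ a) (hqc : ¬ (q : ℤ) ∣ c)
    (hd : (n : ℤ) ∣ a * P - c) :
    (a = P - E ∧ |c| = E) ∨ (a = P - E - s ∧ |c| = P + E) := by
  obtain ⟨hE1, hE6⟩ := h.Ebd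
  have hP := h.P25
  obtain ⟨hc1, hc2⟩ := abs_le.mp hc
  obtain ⟨Q, hQ, -, -⟩ := h.qP
  obtain ⟨k, hk⟩ := hd
  rw [h.hn] at hk
  have hs := h.hs
  have hs' : -1 ≤ s ∧ s ≤ 1 := by rcases h.hs with h | h <;> omega
  have hsE : -E ≤ s * E ∧ s * E ≤ E := by rcases h.hs with h | h <;> subst h <;> constructor <;> linarith
  have hn0 : 0 < (P - E) * P + s * E := by nlinarith
  have hk0 : 0 ≤ k := by
    by_contra hcon
    have : k ≤ -1 := by omega
    nlinarith
  have hk2 : k < 2 := by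
    by_contra hcon
    have : 2 ≤ k := by omega
    nlinarith
  have hk1 : k = 1 := by
    rcases (by omega : k = 0 ∨ k = 1) with h0 | h0
    · exfalso
      apply hqc
      subst h0
      exact ⟨a * Q, by rw [hQ] at hk; linear_combination -hk⟩
    · exact h0
  subst hk1
  obtain ⟨i, rfl⟩ : ∃ i, a = P - E + i := ⟨a - (P - E), by ring⟩
  have hi : i * P = s * E + c := by linear_combination hk
  have hi1 : -2 < i := by
    by_contra hcon
    have : i ≤ -2 := by omega
    nlinarith
  have hi2 : i < 2 := by
    by_contra hcon
    have : 2 ≤ i := by omega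
    nlinarith
  have hDs : (q : ℤ) ∣ P - E + s := by
    have := dvd_sub (Dvd.intro Q hQ.symm : (q : ℤ) ∣ P) h.qE
    rwa [show P - (E - s) = P - E + s by ring] at this
  have hne : i ≠ s := by
    rintro rfl
    exact hqa hDs
  rcases (by omega : i = 0 ∨ i = - s) with h0 | h0
  · left
    subst h0
    refine ⟨by ring, ?_⟩
    have : c = - (s * E) := by linarith
    rw [this, abs_neg]
    rcases hs with h | h <;> subst h
    · rw [one_mul, abs_of_pos (by omega)]
    · rw [neg_one_mul, abs_neg, abs_of_pos (by omega)]
  · right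
    subst h0
    refine ⟨by ring, ?_⟩
    have : c = - (s * (P + E)) := by linarith
    rw [this, abs_neg]
    rcases hs with h | h <;> subst h
    · rw [one_mul, abs_of_pos (by omega)]
    · rw [neg_one_mul, abs_neg, abs_of_pos (by omega)]

theorem Setup.core (h : Setup q t n P s E) (a c : ℤ) (ha : 1 ≤ a) (ha' : a ≤ 2 * (P - E) - 2)
    (hc : |c| ≤ 2 * (P - E) - 2) (hqa : ¬ (q : ℤ) ∣ a) (hqc : ¬ (q : ℤ) ∣ c) (j : ℕ) (hj : j ≤ t)
    (hd : (n : ℤ) ∣ a * (q : ℤ) ^ j - c) :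
    (a = c ∧ j = 0) ∨ (a = P - E ∧ |c| = E) ∨ (a = P - E - s ∧ |c| = P + E) := by
  rcases hj.eq_or_lt with rfl | hlt
  · right
    rw [← h.hP] at hd
    exact h.core_t a c ha ha' hc hqa hqc hd
  · left
    have hq : (5 : ℤ) ≤ q := by exact_mod_cast h.hq
    obtain ⟨hE1, hE6⟩ := h.Ebd
    have hP := h.P25
    obtain ⟨hc1, hc2⟩ := abs_le.mp hc
    obtain ⟨Q, hQ, hQ', hQ5⟩ := h.qP
    have hjQ : (q : ℤ) ^ j ≤ Q := by
      rw [hQ']; exact pow_le_pow_right₀ (by linarith) (by omega)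
    have hj1 : 1 ≤ (q : ℤ) ^ j := one_le_pow₀ (by linarith)
    have hsE : -E ≤ s * E ∧ s * E ≤ E := by
      rcases h.hs with h | h <;> subst h <;> constructor <;> linarith
    have h1 : a * (q : ℤ) ^ j ≤ (2 * (P - E) - 2) * Q :=
      mul_le_mul ha' hjQ (by linarith) (by linarith)
    have h0 : 0 ≤ a * (q : ℤ) ^ j := by positivity
    have hPQ : 5 * Q ≤ P := by rw [hQ]; nlinarith
    have hn1 : (P - E) * (5 * Q) ≤ (P - E) * P := mul_le_mul_of_nonneg_left hPQ (by linarith)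
    have hn2 : (P - E) * 5 ≤ (P - E) * Q := mul_le_mul_of_nonneg_left hQ5 (by linarith)
    have hz : a * (q : ℤ) ^ j - c = 0 := by
      apply Int.eq_zero_of_abs_lt_dvd hd
      rw [h.hn, abs_lt]
      constructor <;> nlinarith
    have hj0 : j = 0 := by
      by_contra hne
      apply hqc
      obtain ⟨i, rfl⟩ := Nat.exists_eq_succ_of_ne_zero hne
      exact ⟨a * (q : ℤ) ^ i, by rw [Nat.succ_eq_add_one, pow_succ] at hz; linear_combination -hz⟩
    subst hj0
    exact ⟨by simpa [sub_eq_zero] using hz, rfl⟩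

/-- the exceptional pairs -/
def Exc (P s E a b : ℤ) : Prop := (a = P - E ∧ b = E) ∨ (a = P - E - s ∧ b = P + E)

theorem Setup.core_pos (h : Setup q t n P s E) (a b : ℤ) (ha : 1 ≤ a) (ha' : a ≤ 2 * (P - E) - 2)
    (hb : 1 ≤ b) (hb' : b ≤ 2 * (P - E) - 2) (hqa : ¬ (q : ℤ) ∣ a) (hqb : ¬ (q : ℤ) ∣ b)
    (j : ℕ) (hj : j ≤ t) (hd : (n : ℤ) ∣ a * (q : ℤ) ^ j - b) :
    (a = b ∧ j = 0) ∨ Exc P s E a b := by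
  have := h.core a b ha ha' (by rwa [abs_of_pos (by omega)]) hqa hqb j hj hd
  rwa [abs_of_pos (by omega)] at this

theorem Setup.core_neg (h : Setup q t n P s E) (a b : ℤ) (ha : 1 ≤ a) (ha' : a ≤ 2 * (P - E) - 2)
    (hb : 1 ≤ b) (hb' : b ≤ 2 * (P - E) - 2) (hqa : ¬ (q : ℤ) ∣ a) (hqb : ¬ (q : ℤ) ∣ b)
    (j : ℕ) (hj : j ≤ t) (hd : (n : ℤ) ∣ a * (q : ℤ) ^ j + b) :
    Exc P s E a b := by
  have := h.core a (-b) ha ha' (by rwa [abs_neg, abs_of_pos (by omega)]) hqa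
    (by rwa [dvd_neg]) j hj (by rwa [sub_neg_eq_add])
  rw [abs_neg, abs_of_pos (by omega)] at this
  rcases this with h | h
  · omega
  · exact h

theorem Setup.qm (h : Setup q t n P s E) : (n : ℤ) ∣ (q : ℤ) ^ (2 * t + 1) + 1 := by
  refine ⟨q + 1, ?_⟩
  have hs : s * s = 1 := by rcases h.hs with h | h <;> subst h <;> norm_num
  rw [h.hn, pow_succ, mul_comm 2 t, pow_mul, ← h.hP]
  linear_combination (P - s) * h.hE - hs

theorem Setup.two (h : Setup q t n P s E) (a b : ℤ) (ha : 1 ≤ a) (ha' : a ≤ 2 * (P - E) - 2)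
    (hb : 1 ≤ b) (hb' : b ≤ 2 * (P - E) - 2) (hqa : ¬ (q : ℤ) ∣ a) (hqb : ¬ (q : ℤ) ∣ b)
    (j : ℕ) (hj : j < 2 * (2 * t + 1)) (hd : (n : ℤ) ∣ a * (q : ℤ) ^ j - b) :
    (a = b ∧ j = 0) ∨ Exc P s E a b ∨ Exc P s E b a := by
  have hm := h.qm
  by_cases h1 : j ≤ t
  · rcases h.core_pos a b ha ha' hb hb' hqa hqb j h1 hd with h | h
    · exact Or.inl h
    · exact Or.inr (Or.inl h)
  by_cases h2 : j ≤ 2 * t + 1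
  · obtain ⟨i, hi⟩ : ∃ i, 2 * t + 1 = j + i := ⟨2 * t + 1 - j, by omega⟩
    rw [hi, pow_add] at hm
    have : (n : ℤ) ∣ b * (q : ℤ) ^ i + a := by
      have := dvd_sub (dvd_mul_of_dvd_right hm a) (dvd_mul_of_dvd_left hd ((q : ℤ) ^ i))
      exact this.trans (dvd_of_eq (by ring))
    exact Or.inr (Or.inr (h.core_neg b a hb hb' ha ha' hqb hqa i (by omega) this))
  by_cases h3 : j ≤ 2 * t + 1 + t
  · obtain ⟨i, rfl⟩ : ∃ i, j = 2 * t + 1 + i := ⟨j - (2 * t + 1), by omega⟩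
    rw [pow_add] at hd
    have : (n : ℤ) ∣ a * (q : ℤ) ^ i + b := by
      have := dvd_sub (dvd_mul_of_dvd_right hm (a * (q : ℤ) ^ i)) hd
      exact this.trans (dvd_of_eq (by ring))
    exact Or.inr (Or.inl (h.core_neg a b ha ha' hb hb' hqa hqb i (by omega) this))
  · obtain ⟨i, hi⟩ : ∃ i, 2 * t + 1 + (2 * t + 1) = j + i := ⟨2 * t + 1 + (2 * t + 1) - j, by omega⟩
    have hm2 : (n : ℤ) ∣ (q : ℤ) ^ j * (q : ℤ) ^ i - 1 := by
      rw [← pow_add, ← hi, pow_add]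
      have := dvd_mul_of_dvd_right hm ((q : ℤ) ^ (2 * t + 1) - 1)
      exact this.trans (dvd_of_eq (by ring))
    have : (n : ℤ) ∣ b * (q : ℤ) ^ i - a := by
      have := dvd_sub (dvd_mul_of_dvd_right hm2 a) (dvd_mul_of_dvd_left hd ((q : ℤ) ^ i))
      exact this.trans (dvd_of_eq (by ring))
    rcases h.core_pos b a hb hb' ha ha' hqb hqa i (by omega) this with h | h
    · omega
    · exact Or.inr (Or.inr h)

/-! ### cosets -/

theorem Setup.pow_order (h : Setup q t n P s E) : (q : ZMod n) ^ (2 * (2 * t + 1)) = 1 := by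
  have h1 : (q : ZMod n) ^ (2 * t + 1) + 1 = 0 := by
    have := (ZMod.intCast_zmod_eq_zero_iff_dvd _ n).mpr h.qm
    simpa using this
  rw [mul_comm, pow_mul, eq_neg_of_add_eq_zero_left h1]
  norm_num

theorem dvd_of_zmod (a b j : ℕ) (h : (a : ZMod n) * (q : ZMod n) ^ j = b) :
    (n : ℤ) ∣ (a : ℤ) * (q : ℤ) ^ j - b := by
  rw [← ZMod.intCast_zmod_eq_zero_iff_dvd]
  push_cast
  rw [h, sub_self]

theorem Setup.not_exc_self (h : Setup q t n P s E) (a : ℤ) : ¬ Exc P s E a a := by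
  obtain ⟨hE1, hE6⟩ := h.Ebd
  have hP := h.P25
  have hs : -1 ≤ s ∧ s ≤ 1 := by rcases h.hs with h | h <;> omega
  rintro (h | h) <;> omega

theorem Setup.order (h : Setup q t n P s E) : orderOf (q : ZMod n) = 2 * (2 * t + 1) := by
  obtain ⟨hE1, hE6⟩ := h.Ebd
  have hP := h.P25
  have hq1 : ¬ (q : ℤ) ∣ 1 := not_dvd_s h.hq (Or.inl rfl)
  have hd := orderOf_dvd_of_pow_eq_one h.pow_order
  have hle := Nat.le_of_dvd (by omega) hd
  have hpos := Nat.pos_of_dvd_of_pos hd (by omega)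
  rcases hle.eq_or_lt with he | hlt
  · exact he
  · exfalso
    have h1 := dvd_of_zmod (q := q) (n := n) 1 1 (orderOf (q : ZMod n))
      (by rw [pow_orderOf_eq_one]; simp)
    have := h.two 1 1 le_rfl (by omega) le_rfl (by omega) hq1 hq1 _ hlt (by simpa using h1)
    rcases this with h2 | h2 | h2
    · omega
    · exact h.not_exc_self _ h2
    · exact h.not_exc_self _ h2

theorem Setup.mem (h : Setup q t n P s E) (a x : ℕ) :
    x ∈ cycCoset q n a ↔ ∃ j, a * q ^ j % n = x := by
  unfold cycCoset
  simp only [Finset.mem_image, Finset.mem_range]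
  constructor
  · rintro ⟨j, -, hj⟩; exact ⟨j, hj⟩
  · rintro ⟨j, rfl⟩
    have hpos : 0 < orderOf (q : ZMod n) := by rw [h.order]; omega
    refine ⟨j % orderOf (q : ZMod n), Nat.mod_lt _ hpos, ?_⟩
    have : ((a * q ^ (j % orderOf (q : ZMod n)) : ℕ) : ZMod n) = ((a * q ^ j : ℕ) : ZMod n) := by
      push_cast
      rw [pow_mod_orderOf]
    exact (ZMod.natCast_eq_natCast_iff' _ _ _).mp this

/-- if `a q^i = ± b q^j` the cosets agree -/
theorem Setup.subset (h : Setup q t n P s E) (a b j : ℕ)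
    (hab : (b : ZMod n) = a * (q : ZMod n) ^ j) : cycCoset q n b ⊆ cycCoset q n a := by
  intro x hx
  rw [h.mem] at hx ⊢
  obtain ⟨i, rfl⟩ := hx
  refine ⟨j + i, ?_⟩
  apply (ZMod.natCast_eq_natCast_iff' _ _ _).mp
  push_cast
  rw [hab, pow_add]
  ring

/-- bounded, not divisible by `q` -/
def Good (q : ℕ) (P E : ℤ) (a : ℕ) : Prop := 1 ≤ a ∧ (a : ℤ) ≤ 2 * (P - E) - 2 ∧ ¬ q ∣ a

theorem Setup.two' (h : Setup q t n P s E) (a b : ℕ) (ha : Good q P E a) (hb : Good q P E b)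
    (j : ℕ) (hj : j < 2 * (2 * t + 1)) (hd : (a : ZMod n) * (q : ZMod n) ^ j = b) :
    (a = b ∧ j = 0) ∨ Exc P s E a b ∨ Exc P s E b a := by
  have := h.two a b (by exact_mod_cast ha.1) ha.2.1 (by exact_mod_cast hb.1) hb.2.1
    (by exact_mod_cast ha.2.2) (by exact_mod_cast hb.2.2) j hj (dvd_of_zmod a b j hd)
  simpa using this

theorem Setup.isUnit (h : Setup q t n P s E) : IsUnit (q : ZMod n) :=
  IsUnit.of_pow_eq_one h.pow_order (by omega)

theorem Setup.card (h : Setup q t n P s E) (a : ℕ) (ha : Good q P E a) :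
    (cycCoset q n a).card = 2 * (2 * t + 1) := by
  unfold cycCoset
  rw [h.order, Finset.card_image_of_injOn, Finset.card_range]
  have key : ∀ i j, i ≤ j → j < 2 * (2 * t + 1) → a * q ^ i % n = a * q ^ j % n → i = j := by
    intro i j hij hj he
    obtain ⟨k, rfl⟩ := Nat.exists_eq_add_of_le hij
    have he' := (ZMod.natCast_eq_natCast_iff' _ _ _).mpr he
    push_cast at he'
    have h1 : (a : ZMod n) * (q : ZMod n) ^ k = a := by
      apply (h.isUnit.pow i).mul_right_cancel
      rw [he', pow_add]; ring
    rcases h.two' a a ha ha k (by omega) h1 with h2 | h2 | h2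
    · omega
    · exact (h.not_exc_self _ h2).elim
    · exact (h.not_exc_self _ h2).elim
  intro i hi j hj he
  simp only [Finset.coe_range, Set.mem_Iio] at hi hj
  rcases le_total i j with hij | hij
  · exact key i j hij hj he
  · exact (key j i hij hi he.symm).symm

theorem Setup.disj (h : Setup q t n P s E) (a b : ℕ) (ha : Good q P E a) (hb : Good q P E b)
    (hab : a ≠ b) (h1 : ¬ Exc P s E a b) (h2 : ¬ Exc P s E b a) :
    Disjoint (cycCoset q n a) (cycCoset q n b) := by
  rw [Finset.disjoint_left]
  intro x hx hy
  unfold cycCoset at hx hy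
  rw [h.order] at hx hy
  simp only [Finset.mem_image, Finset.mem_range] at hx hy
  obtain ⟨i, hi, rfl⟩ := hx
  obtain ⟨j, hj, he⟩ := hy
  have he' := (ZMod.natCast_eq_natCast_iff' _ _ _).mpr he
  push_cast at he'
  rcases le_total i j with hij | hij
  · obtain ⟨k, rfl⟩ := Nat.exists_eq_add_of_le hij
    have h3 : (b : ZMod n) * (q : ZMod n) ^ k = a := by
      apply (h.isUnit.pow i).mul_right_cancel
      rw [← he', pow_add]; ring
    rcases h.two' b a hb ha k (by omega) h3 with h4 | h4 | h4
    · exact hab h4.1.symm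
    · exact h2 h4
    · exact h1 h4
  · obtain ⟨k, rfl⟩ := Nat.exists_eq_add_of_le hij
    have h3 : (a : ZMod n) * (q : ZMod n) ^ k = b := by
      apply (h.isUnit.pow j).mul_right_cancel
      rw [he', pow_add]; ring
    rcases h.two' a b ha hb k (by omega) h3 with h4 | h4 | h4
    · exact hab h4.1
    · exact h1 h4
    · exact h2 h4

theorem Setup.subset_of_int (h : Setup q t n P s E) (a b : ℕ) (σ : ℤ) (hσ : σ = 1 ∨ σ = -1)
    (hd : (n : ℤ) ∣ (b : ℤ) * P + σ * a) : cycCoset q n b ⊆ cycCoset q n a := by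
  have hm : (q : ZMod n) ^ (2 * t + 1) = -1 := by
    have := (ZMod.intCast_zmod_eq_zero_iff_dvd _ n).mpr h.qm
    push_cast at this
    exact eq_neg_of_add_eq_zero_left this
  have h0 := (ZMod.intCast_zmod_eq_zero_iff_dvd _ n).mpr hd
  rw [h.hP] at h0
  push_cast at h0
  have hb : (b : ZMod n) * (q : ZMod n) ^ (2 * t + 1)
      = - (b : ZMod n) := by rw [hm]; ring
  have h1 : (b : ZMod n) = (σ : ZMod n) * a * (q : ZMod n) ^ (t + 1) := by
    have e : (q : ZMod n) ^ (2 * t + 1) = (q : ZMod n) ^ t * (q : ZMod n) ^ (t + 1) := by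
      rw [← pow_add]; congr 1; omega
    rw [e] at hb
    linear_combination hb - (q : ZMod n) ^ (t + 1) * h0
  rcases hσ with rfl | rfl
  · exact h.subset a b (t + 1) (by simpa using h1)
  · apply h.subset a b (2 * t + 1 + (t + 1))
    rw [h1, pow_add _ (2 * t + 1) (t + 1), hm]
    push_cast
    ring

theorem Setup.subset_of_int' (h : Setup q t n P s E) (a b : ℕ) (σ : ℤ) (hσ : σ = 1 ∨ σ = -1)
    (hd : (n : ℤ) ∣ (b : ℤ) * P + σ * a) : cycCoset q n a ⊆ cycCoset q n b := by
  have hm : (q : ZMod n) ^ (2 * t + 1) = -1 := by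
    have := (ZMod.intCast_zmod_eq_zero_iff_dvd _ n).mpr h.qm
    push_cast at this
    exact eq_neg_of_add_eq_zero_left this
  have h0 := (ZMod.intCast_zmod_eq_zero_iff_dvd _ n).mpr hd
  rw [h.hP] at h0
  push_cast at h0
  rcases hσ with rfl | rfl
  · apply h.subset b a (2 * t + 1 + t)
    rw [pow_add, hm]
    push_cast at h0
    linear_combination h0
  · apply h.subset b a t
    push_cast at h0
    linear_combination -h0

/-- the reduced index set -/
def L (q : ℕ) (P E : ℤ) (d : ℕ) : Finset ℕ :=
  (Finset.Icc 1 d).filter fun a => ¬ q ∣ a ∧ (a : ℤ) ≠ P - E ∧ (a : ℤ) ≠ P + E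

theorem Setup.union (h : Setup q t n P s E) (d : ℕ) :
    (Finset.Icc 1 d).biUnion (cycCoset q n) = (L q P E d).biUnion (cycCoset q n) := by
  obtain ⟨hE1, hE6⟩ := h.Ebd
  have hP := h.P25
  have hs : s = 1 ∨ s = -1 := h.hs
  apply Finset.Subset.antisymm
  · have key : ∀ a, 1 ≤ a → a ≤ d → ∃ b ∈ L q P E d, cycCoset q n a ⊆ cycCoset q n b := by
      intro a
      induction a using Nat.strong_induction_on with
      | _ a ih =>
        intro ha1 had
        by_cases hqa : q ∣ a
        · obtain ⟨c, rfl⟩ := hqa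
          have hc : 1 ≤ c := by
            rcases Nat.eq_zero_or_pos c with h0 | h0
            · subst h0; omega
            · exact h0
          have hlt : c < q * c := by have := h.hq; nlinarith
          obtain ⟨b, hb, hsub⟩ := ih c hlt hc (by omega)
          refine ⟨b, hb, (h.subset c (q * c) 1 ?_).trans hsub⟩
          push_cast; ring
        by_cases hD : (a : ℤ) = P - E
        · obtain ⟨e, rfl⟩ := Int.eq_ofNat_of_zero_le (by omega : 0 ≤ E)
          obtain ⟨b, hb, hsub⟩ := ih e (by omega) (by omega) (by omega)
          refine ⟨b, hb, (h.subset_of_int e a s hs ?_).trans hsub⟩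
          rw [h.hn, hD]
        by_cases hA : (a : ℤ) = P + E
        · obtain ⟨e, he⟩ := Int.eq_ofNat_of_zero_le (by omega : 0 ≤ P - E - s)
          obtain ⟨b, hb, hsub⟩ := ih e (by omega) (by omega) (by omega)
          refine ⟨b, hb, Finset.Subset.trans (h.subset_of_int' a e s hs ?_) hsub⟩
          have he' : (e : ℤ) = P - E - s := he.symm
          rw [h.hn, he', hA]
          exact dvd_of_eq (by ring)
        · exact ⟨a, by simp [L, ha1, had, hqa, hD, hA], Finset.Subset.refl _⟩
    intro x hx
    rw [Finset.mem_biUnion] at hx ⊢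
    obtain ⟨a, ha, hxa⟩ := hx
    rw [Finset.mem_Icc] at ha
    obtain ⟨b, hb, hsub⟩ := key a ha.1 ha.2
    exact ⟨b, hb, hsub hxa⟩
  · exact Finset.biUnion_subset_biUnion_of_subset_left _ (Finset.filter_subset _ _)

theorem Setup.card_union (h : Setup q t n P s E) (d : ℕ) (hd : (d : ℤ) ≤ 2 * (P - E) - 2) :
    ((Finset.Icc 1 d).biUnion (cycCoset q n)).card = 2 * (2 * t + 1) * (L q P E d).card := by
  have good : ∀ a ∈ L q P E d, Good q P E a ∧ (a : ℤ) ≠ P - E ∧ (a : ℤ) ≠ P + E := by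
    intro a ha
    simp only [L, Finset.mem_filter, Finset.mem_Icc] at ha
    refine ⟨⟨ha.1.1, ?_, ha.2.1⟩, ha.2.2⟩
    have := ha.1.2
    omega
  rw [h.union, Finset.card_biUnion, Finset.sum_congr rfl fun a ha => h.card a (good a ha).1,
    Finset.sum_const, smul_eq_mul, mul_comm]
  intro a ha b hb hab
  obtain ⟨ga, ha1, ha2⟩ := good a ha
  obtain ⟨gb, hb1, hb2⟩ := good b hb
  apply h.disj a b ga gb hab
  · rintro (h | h)
    · exact ha1 h.1
    · exact hb2 h.2
  · rintro (h | h)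
    · exact hb1 h.1
    · exact ha2 h.2

theorem Setup.card_L (h : Setup q t n P s E) (d : ℕ) (hd : P + 1 ≤ (d : ℤ)) :
    ((L q P E d).card : ℤ) = d - (d / q : ℕ) - 1 - (if P + E ≤ (d : ℤ) then 1 else 0) := by
  obtain ⟨hE1, hE6⟩ := h.Ebd
  have hP := h.P25
  obtain ⟨D, hD⟩ := Int.eq_ofNat_of_zero_le (by omega : 0 ≤ P - E)
  obtain ⟨A, hA⟩ := Int.eq_ofNat_of_zero_le (by omega : 0 ≤ P + E)
  have hqD : ¬ q ∣ D := by have := h.D_nd; rw [hD] at this; exact_mod_cast this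
  have hqA : ¬ q ∣ A := by have := h.A_nd; rw [hA] at this; exact_mod_cast this
  set M := (Finset.Icc 1 d).filter fun a => ¬ q ∣ a with hM
  have hMc : (M.card : ℤ) = d - (d / q : ℕ) := by
    have h1 := Finset.card_filter_add_card_filter_not (s := Finset.Icc 1 d) (fun a => q ∣ a)
    have h2 : ((Finset.Icc 1 d).filter fun a => q ∣ a).card = d / q := by
      have := Nat.Ioc_filter_dvd_card_eq_div d q
      rw [← this]
      rfl
    rw [h2, Nat.card_Icc] at h1
    rw [hM]
    omega
  have hLM : L q P E d = (M.erase D).erase A := by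
    ext a
    simp only [L, hM, hD, hA, Finset.mem_filter, Finset.mem_erase, Finset.mem_Icc]
    constructor
    · rintro ⟨h1, h2, h3, h4⟩
      exact ⟨by exact_mod_cast h4, by exact_mod_cast h3, h1, h2⟩
    · rintro ⟨h4, h3, h1, h2⟩
      exact ⟨h1, h2, by exact_mod_cast h3, by exact_mod_cast h4⟩
  have hDM : D ∈ M := by
    simp only [hM, Finset.mem_filter, Finset.mem_Icc]
    exact ⟨by omega, hqD⟩
  have hc1 := Finset.card_erase_add_one hDM
  rw [hLM]
  split_ifs with hif
  · have hAM : A ∈ M.erase D := by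
      simp only [hM, Finset.mem_erase, Finset.mem_filter, Finset.mem_Icc]
      exact ⟨by omega, by omega, hqA⟩
    have hc2 := Finset.card_erase_add_one hAM
    omega
  · have hAM : A ∉ M.erase D := by
      simp only [hM, Finset.mem_erase, Finset.mem_filter, Finset.mem_Icc]
      rintro ⟨-, h1, -⟩
      omega
    rw [Finset.erase_eq_of_notMem hAM]
    omega

theorem ceil_eq (q d : ℕ) (hq : 0 < q) :
    ⌈(d : ℚ) * (1 - (q : ℚ)⁻¹)⌉ = (d : ℤ) - (d / q : ℕ) := by
  have h1 : (d : ℚ) * (1 - (q : ℚ)⁻¹) = (d : ℤ) + -((d : ℚ) / (q : ℚ)) := by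
    push_cast
    rw [div_eq_mul_inv]; ring
  rw [h1, Int.ceil_intCast_add, Int.ceil_neg, Rat.floor_natCast_div_natCast]
  push_cast
  ring

theorem Setup.main (h : Setup q t n P s E) (δ : ℕ) (h1 : P + 2 ≤ (δ : ℤ))
    (h2 : (δ : ℤ) ≤ 2 * (P - E) - 1) :
    ((((Finset.Icc 1 (δ - 1)).biUnion (cycCoset q n)).card : ℕ) : ℤ) =
      2 * (2 * t + 1 : ℕ) * (⌈((δ : ℚ) - 1) * (1 - (q : ℚ)⁻¹)⌉ - 1 -
        (if P + E + 1 ≤ (δ : ℤ) then 1 else 0)) := by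
  have hP := h.P25
  obtain ⟨d, rfl⟩ : ∃ d, δ = d + 1 := ⟨δ - 1, by omega⟩
  rw [Nat.add_sub_cancel, h.card_union d (by push_cast at h2; omega)]
  have : ((d + 1 : ℕ) : ℚ) - 1 = (d : ℚ) := by push_cast; ring
  rw [this, ceil_eq q d (by have := h.hq; omega)]
  push_cast
  rw [h.card_L d (by push_cast at h1; omega)]
  simp

end BCHAux

/-- dimension of BCH codes of length `n = (q^m+1)/(q+1)` for odd prime
power `q ≥ 5`, `m = 2t+1 ≥ 5`, expressed via `|C_1 ∪ ⋯ ∪ C_{δ-1}| = n - k`. -/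
theorem stmt_17 (q t m n : ℕ) (hq : IsPrimePow q) (hodd : Odd q) (hq5 : 5 ≤ q)
    (hm : m = 2 * t + 1) (hm5 : 5 ≤ m) (hn : n = (q ^ m + 1) / (q + 1))
    (A B : ℕ)
    (hAodd : Odd t → A = (q ^ (t + 1) + 2 * q ^ t + 1) / (q + 1))
    (hBodd : Odd t → B = 2 * ((q ^ (t + 1) - 1) / (q + 1)) - 1)
    (hAeven : Even t → A = (q ^ (t + 1) + 2 * q ^ t - 1) / (q + 1))
    (hBeven : Even t → B = 2 * ((q ^ (t + 1) + 1) / (q + 1)) - 1)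
    (δ : ℕ) (ε : ℤ) (hε : ε = ⌈((δ : ℚ) - 1) * (1 - (q : ℚ)⁻¹)⌉)
    (N : ℤ) (hN : N = ((Finset.Icc 1 (δ - 1)).biUnion (cycCoset q n)).card) :
    (q ^ t + 2 ≤ δ → δ ≤ A →
      N = (n : ℤ) - ((n : ℤ) - 2 * (m : ℤ) * (ε - 1))) ∧
    (A + 1 ≤ δ → δ ≤ B →
      N = (n : ℤ) - ((n : ℤ) - 2 * (m : ℤ) * (ε - 2))) := by
  have hq0 : (5 : ℤ) ≤ q := by exact_mod_cast hq5
  have hq1 : (q : ℤ) + 1 ≠ 0 := by omega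
  have hA0 : ∃ s E : ℤ, BCHAux.Setup q t n ((q : ℤ) ^ t) s E ∧
      (A : ℤ) = (q : ℤ) ^ t + E ∧ (B : ℤ) = 2 * ((q : ℤ) ^ t - E) - 1 := by
    obtain ⟨E, hE⟩ := sub_dvd_pow_sub_pow (q : ℤ) (-1) t
    have hnn : ∀ s : ℤ, (s = 1 ∨ s = -1) → E * ((q : ℤ) + 1) = (q : ℤ) ^ t + s →
        BCHAux.Setup q t n ((q : ℤ) ^ t) s E := by
      intro s hs hEs
      refine ⟨hq5, by omega, rfl, hs, hEs, ?_⟩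
      have hs2 : s * s = 1 := by rcases hs with h | h <;> subst h <;> norm_num
      rw [hn, hm]
      push_cast
      apply Int.ediv_eq_of_eq_mul_right hq1
      rw [pow_succ, mul_comm 2 t, pow_mul]
      linear_combination ((q : ℤ) ^ t - s) * hEs - hs2
    have hpos : 1 ≤ q ^ t := Nat.one_le_pow _ _ (by omega)
    have hpos' : 1 ≤ q ^ (t + 1) := Nat.one_le_pow _ _ (by omega)
    rcases Nat.even_or_odd t with he | ho
    · rw [he.neg_one_pow] at hE
      have hEs : E * ((q : ℤ) + 1) = (q : ℤ) ^ t + (-1) := by linear_combination -hE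
      have hS := hnn (-1) (Or.inr rfl) hEs
      have := hS.Ebd
      have h25 := hS.P25
      refine ⟨-1, E, hS, ?_, ?_⟩
      · rw [hAeven he]
        push_cast [Nat.cast_sub (by omega : 1 ≤ q ^ (t + 1) + 2 * q ^ t)]
        apply Int.ediv_eq_of_eq_mul_right hq1
        rw [pow_succ]
        linear_combination -hEs
      · have e : (((q ^ (t + 1) + 1) / (q + 1) : ℕ) : ℤ) = (q : ℤ) ^ t - E := by
          push_cast
          apply Int.ediv_eq_of_eq_mul_right hq1
          rw [pow_succ]
          linear_combination hEs
        rw [hBeven he]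
        omega
    · rw [ho.neg_one_pow] at hE
      have hEs : E * ((q : ℤ) + 1) = (q : ℤ) ^ t + 1 := by linear_combination -hE
      have hS := hnn 1 (Or.inl rfl) hEs
      have := hS.Ebd
      have h25 := hS.P25
      refine ⟨1, E, hS, ?_, ?_⟩
      · rw [hAodd ho]
        push_cast
        apply Int.ediv_eq_of_eq_mul_right hq1
        rw [pow_succ]
        linear_combination -hEs
      · have e : (((q ^ (t + 1) - 1) / (q + 1) : ℕ) : ℤ) = (q : ℤ) ^ t - E := by
          push_cast [Nat.cast_sub hpos']
          apply Int.ediv_eq_of_eq_mul_right hq1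
          rw [pow_succ]
          linear_combination hEs
        rw [hBodd ho]
        omega
  obtain ⟨s, E, hS, hA, hB⟩ := hA0
  obtain ⟨hE1, hE6⟩ := hS.Ebd
  have h25 := hS.P25
  have hPc : ((q ^ t : ℕ) : ℤ) = (q : ℤ) ^ t := by push_cast; rfl
  constructor
  · intro h1 h2
    have h1' : (q : ℤ) ^ t + 2 ≤ (δ : ℤ) := by rw [← hPc]; exact_mod_cast h1
    have := hS.main δ h1' (by omega)
    rw [← hε, if_neg (by omega), ← hm] at this
    rw [hN, this]
    ring
  · intro h1 h2
    have := hS.main δ (by omega) (by omega)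
    rw [← hε, if_pos (by omega), ← hm] at this
    rw [hN, this]
    ring
end

section
/- Let m ≥ 5 be an odd integer and n = (3^m+1)/4. Then the first and second largest coset leaders modulo n are δ_{1,n} = (3^{m-1}-1)/8 and δ_{2,n} = (3^{m-1}-1)/8 - 2. Moreover, the 3-cyclotomic cosets of δ_{1,n} and of δ_{2,n} modulo n each have exactly 2m elements. -/
lemma aux_mem_s19 (n s j : ℕ) (ho : 0 < orderOf ((3 : ℕ) : ZMod n)) :
    s * 3 ^ j % n ∈ cycCoset 3 n s := by
  unfold cycCoset
  rw [Finset.mem_image]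
  refine ⟨j % orderOf ((3 : ℕ) : ZMod n), Finset.mem_range.2 (Nat.mod_lt _ ho), ?_⟩
  rw [← ZMod.natCast_eq_natCast_iff']
  rw [Nat.cast_mul, Nat.cast_mul, Nat.cast_pow, Nat.cast_pow, pow_mod_orderOf]

lemma aux_pow (m n : ℕ) (h : 3 ^ m + 1 = 4 * n) : ((3 : ℕ) : ZMod n) ^ (2 * m) = 1 := by
  have h1 : (((3 ^ m + 1 : ℕ)) : ZMod n) = 0 := by
    rw [h]; simp
  have h2 : ((3 : ℕ) : ZMod n) ^ m = -1 := by
    push_cast at h1 ⊢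
    exact eq_neg_of_add_eq_zero_left h1
  rw [mul_comm, pow_mul, h2]; norm_num

lemma aux_ord (m n : ℕ) (hm : 0 < m) (h : 3 ^ m + 1 = 4 * n) :
    0 < orderOf ((3 : ℕ) : ZMod n) := by
  rw [orderOf_pos_iff, isOfFinOrder_iff_pow_eq_one]
  exact ⟨2 * m, by omega, aux_pow m n h⟩

/-- the residue of `s * 3^(j+m)` is the negative of that of `s * 3^j` -/
lemma aux_neg (m n s j : ℕ) (h : 3 ^ m + 1 = 4 * n) (h0 : 0 < s * 3 ^ j % n) :
    s * 3 ^ (j + m) % n = n - s * 3 ^ j % n := by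
  have hn : 0 < n := by
    have := Nat.one_le_pow m 3 (by norm_num)
    omega
  have h1 : s * 3 ^ (j + m) + s * 3 ^ j = n * (4 * (s * 3 ^ j)) := by
    have : s * 3 ^ (j + m) + s * 3 ^ j = s * 3 ^ j * (3 ^ m + 1) := by ring
    rw [this, h]; ring
  have h2 : (s * 3 ^ (j + m) % n + s * 3 ^ j % n) % n = 0 := by
    rw [← Nat.add_mod, h1]; simp
  have h3 := Nat.mod_lt (s * 3 ^ (j + m)) hn
  have h4 := Nat.mod_lt (s * 3 ^ j) hn
  obtain ⟨c, hc⟩ := Nat.dvd_of_mod_eq_zero h2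
  have : c = 1 := by
    rcases c with _ | _ | c
    · omega
    · rfl
    · exfalso
      have : n * (c + 1 + 1) = n * c + n + n := by ring
      have := Nat.zero_le (n * c)
      omega
  subst this
  omega

/-- strict minimality gives a leader with a full coset -/
lemma aux_leader_s19 (m n s : ℕ) (hm : 0 < m) (h : 3 ^ m + 1 = 4 * n) (hs : 0 < s) (hsn : 2 * s < n)
    (H : ∀ k, 1 ≤ k → k < m → s < s * 3 ^ k % n ∧ s * 3 ^ k % n < n - s) :
    s ∈ cosetLeaders 3 n ∧ (cycCoset 3 n s).card = 2 * m := by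
  have hsm : s % n = s := Nat.mod_eq_of_lt (by omega)
  have H2 : ∀ k, 1 ≤ k → k < 2 * m → s < s * 3 ^ k % n := by
    intro k hk hk2
    by_cases hkm : k < m
    · exact (H k hk hkm).1
    · obtain ⟨i, rfl⟩ : ∃ i, k = i + m := ⟨k - m, by omega⟩
      have key : s ≤ s * 3 ^ i % n ∧ s * 3 ^ i % n < n - s := by
        rcases Nat.eq_zero_or_pos i with rfl | hi
        · simp [hsm]; omega
        · have := H i hi (by omega); omega
      rw [aux_neg m n s i h (by omega)]
      omega
  have ho := aux_ord m n hm h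
  have hord : orderOf ((3 : ℕ) : ZMod n) = 2 * m := by
    have hle : orderOf ((3 : ℕ) : ZMod n) ≤ 2 * m :=
      orderOf_le_of_pow_eq_one (by omega) (aux_pow m n h)
    by_contra hne
    have h1 := H2 _ ho (by omega)
    have h2 : s * 3 ^ (orderOf ((3 : ℕ) : ZMod n)) % n = s % n := by
      rw [← ZMod.natCast_eq_natCast_iff', Nat.cast_mul, Nat.cast_pow, pow_orderOf_eq_one, mul_one]
    omega
  have hcop : Nat.Coprime n 3 := by
    rw [Nat.coprime_comm, Nat.Prime.coprime_iff_not_dvd Nat.prime_three]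
    rintro ⟨c, hc⟩
    obtain ⟨m, rfl⟩ : ∃ i, m = i + 1 := ⟨m - 1, by omega⟩
    rw [pow_succ] at h
    omega
  refine ⟨?_, ?_⟩
  · unfold cosetLeaders
    rw [Finset.mem_filter, Finset.mem_range]
    refine ⟨by omega, ?_, ?_⟩
    · have := aux_mem_s19 n s 0 ho
      simpa [hsm] using this
    · intro x hx
      unfold cycCoset at hx
      rw [Finset.mem_image] at hx
      obtain ⟨j, hj, rfl⟩ := hx
      rw [Finset.mem_range, hord] at hj
      rcases Nat.eq_zero_or_pos j with rfl | hj0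
      · simp [hsm]
      · exact (H2 j hj0 hj).le
  · unfold cycCoset
    rw [hord, Finset.card_image_of_injOn, Finset.card_range]
    have main : ∀ i j, i < j → j < 2 * m → s * 3 ^ i % n = s * 3 ^ j % n → False := by
      intro i j hij hj he
      have h1 := H2 (j - i) (by omega) (by omega)
      have h2 : s * 3 ^ (j - i) % n = s % n := by
        have e : s * 3 ^ j = 3 ^ i * (s * 3 ^ (j - i)) := by
          have : 3 ^ j = 3 ^ i * 3 ^ (j - i) := by rw [← pow_add]; congr 1; omega
          rw [this]; ring
        have e2 : 3 ^ i * (s * 3 ^ (j - i)) ≡ 3 ^ i * s [MOD n] := by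
          rw [← e, mul_comm (3 ^ i) s]; exact he.symm
        exact Nat.ModEq.cancel_left_of_coprime (Nat.Coprime.pow_right i hcop) e2
      omega
    intro i hi j hj he
    simp only [Finset.coe_range, Set.mem_Iio] at hi hj
    rcases lt_trichotomy i j with h1 | h1 | h1
    · exact (main i j h1 hj he).elim
    · exact h1
    · exact (main j i h1 hi he.symm).elim

lemma aux_d1 (m w : ℕ) (hm5 : 5 ≤ m) (hw : 1 ≤ w) (h : 3 ^ (m - 3) = 8 * w + 1) (k : ℕ)
    (hk : 1 ≤ k) (hkm : k < m) :
    9 * w + 1 < (9 * w + 1) * 3 ^ k % (54 * w + 7) ∧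
    (9 * w + 1) * 3 ^ k % (54 * w + 7) < (54 * w + 7) - (9 * w + 1) := by
  obtain ⟨k, rfl⟩ : ∃ i, k = i + 1 := ⟨k - 1, by omega⟩
  have hle : 3 ^ k ≤ 24 * w + 3 := by
    have h1 : 3 ^ k ≤ 3 ^ (m - 3 + 1) := Nat.pow_le_pow_right (by norm_num) (by omega)
    rw [pow_succ, h] at h1; omega
  obtain ⟨q, hq⟩ : Odd (3 ^ k) := Odd.pow (by decide)
  have : (9 * w + 1) * 3 ^ (k + 1) % (54 * w + 7) = 27 * w + 3 - q := by
    have e : (9 * w + 1) * 3 ^ (k + 1) = (27 * w + 3 - q) + (54 * w + 7) * q := by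
      rw [pow_succ, hq]
      zify [show q ≤ 27 * w + 3 by omega]
      ring
    rw [e, Nat.add_mul_mod_self_left, Nat.mod_eq_of_lt (by omega)]
  omega

lemma aux_d2 (m w : ℕ) (hm5 : 5 ≤ m) (hw : 1 ≤ w) (h : 3 ^ (m - 3) = 8 * w + 1) (k : ℕ)
    (hk : 1 ≤ k) (hkm : k < m) :
    9 * w - 1 < (9 * w - 1) * 3 ^ k % (54 * w + 7) ∧
    (9 * w - 1) * 3 ^ k % (54 * w + 7) < (54 * w + 7) - (9 * w - 1) := by
  obtain ⟨k, rfl⟩ : ∃ i, k = i + 1 := ⟨k - 1, by omega⟩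
  obtain ⟨v, rfl⟩ : ∃ v, w = v + 1 := ⟨w - 1, by omega⟩
  rw [show 9 * (v + 1) - 1 = 9 * v + 8 by omega]
  have hcase : k = m - 2 ∨ k = m - 3 ∨ k ≤ m - 4 := by omega
  rcases hcase with hc | hc | hc
  · have hp : 3 ^ k = 24 * v + 27 := by
      rw [hc, show m - 2 = m - 3 + 1 by omega, pow_succ, h]; ring
    have : (9 * v + 8) * 3 ^ (k + 1) % (54 * (v + 1) + 7) = 33 * v + 38 := by
      have e : (9 * v + 8) * 3 ^ (k + 1) = (33 * v + 38) + (54 * (v + 1) + 7) * (12 * v + 10) := by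
        rw [pow_succ, hp]; ring
      rw [e, Nat.add_mul_mod_self_left, Nat.mod_eq_of_lt (by omega)]
    omega
  · have hp : 3 ^ k = 8 * v + 9 := by
      rw [hc, h]; ring
    have : (9 * v + 8) * 3 ^ (k + 1) % (54 * (v + 1) + 7) = 29 * v + 33 := by
      have e : (9 * v + 8) * 3 ^ (k + 1) = (29 * v + 33) + (54 * (v + 1) + 7) * (4 * v + 3) := by
        rw [pow_succ, hp]; ring
      rw [e, Nat.add_mul_mod_self_left, Nat.mod_eq_of_lt (by omega)]
    omega
  · have hle : 3 * 3 ^ k ≤ 8 * v + 9 := by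
      have h1 : 3 ^ (k + 1) ≤ 3 ^ (m - 3) := Nat.pow_le_pow_right (by norm_num) (by omega)
      rw [h, pow_succ] at h1; omega
    obtain ⟨q, hq⟩ : Odd (3 ^ k) := Odd.pow (by decide)
    have : (9 * v + 8) * 3 ^ (k + 1) % (54 * (v + 1) + 7) = 27 * v + 24 - 13 * q := by
      have e : (9 * v + 8) * 3 ^ (k + 1) = (27 * v + 24 - 13 * q) + (54 * (v + 1) + 7) * q := by
        rw [pow_succ, hq]
        zify [show 13 * q ≤ 27 * v + 24 by omega]
        ring
      rw [e, Nat.add_mul_mod_self_left, Nat.mod_eq_of_lt (by omega)]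
    omega

/-- parity argument: leaders are at most `9w+1` -/
lemma aux_upper (m w s : ℕ) (hm : Odd m) (h : 3 ^ m + 1 = 4 * (54 * w + 7))
    (hs : s ∈ cosetLeaders 3 (54 * w + 7)) : s ≤ 9 * w + 1 := by
  by_contra hlt
  push Not at hlt
  obtain ⟨n, hn⟩ : ∃ n, n = 54 * w + 7 := ⟨_, rfl⟩
  rw [← hn] at h hs
  unfold cosetLeaders at hs
  rw [Finset.mem_filter, Finset.mem_range] at hs
  obtain ⟨hsn, -, hmin⟩ := hs
  have ho := aux_ord m n hm.pos h
  have hL : ∀ j, s ≤ s * 3 ^ j % n := fun j => hmin _ (aux_mem_s19 n s j ho)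
  have hL2 : ∀ j, s * 3 ^ j % n ≤ n - s := by
    intro j
    have h1 := hL j
    have h2 := hL (j + m)
    rw [aux_neg m n s j h (by omega)] at h2
    omega
  have hs2 : 2 * s < n := by
    have := hL2 0
    rw [pow_zero, mul_one, Nat.mod_eq_of_lt hsn] at this
    omega
  have inv : ∀ j, ∃ z, z % 2 = (s + j) % 2 ∧ 2 * z < n ∧ s ≤ z ∧
      (z = s * 3 ^ j % n ∨ n - z = s * 3 ^ j % n) := by
    intro j
    induction j with
    | zero => exact ⟨s, by simp, hs2, le_rfl, Or.inl (by simp [Nat.mod_eq_of_lt hsn])⟩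
    | succ j ih =>
      obtain ⟨z, hz1, hz2, hz3, hz4⟩ := ih
      have hr1 := hL (j + 1)
      have hr2 := hL2 (j + 1)
      have e : s * 3 ^ (j + 1) % n = (s * 3 ^ j % n) * 3 % n := by
        rw [pow_succ, ← mul_assoc, Nat.mod_mul_mod]
      rw [e] at hr1 hr2 ⊢
      have hmod : ∀ a b c, a = b + n * c → b < n → a % n = b := by
        intro a b c h1 h2
        rw [h1, Nat.add_mul_mod_self_left, Nat.mod_eq_of_lt h2]
      by_cases hz : 3 * z < n
      · refine ⟨n - 3 * z, by omega, by omega, ?_⟩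
        rcases hz4 with h4 | h4
        · have := hmod (s * 3 ^ j % n * 3) (3 * z) 0 (by omega) (by omega)
          omega
        · have := hmod (s * 3 ^ j % n * 3) (n - 3 * z) 2 (by omega) (by omega)
          omega
      · refine ⟨3 * z - n, by omega, by omega, ?_⟩
        rcases hz4 with h4 | h4
        · have := hmod (s * 3 ^ j % n * 3) (3 * z - n) 1 (by omega) (by omega)
          omega
        · have := hmod (s * 3 ^ j % n * 3) (2 * n - 3 * z) 1 (by omega) (by omega)
          omega
  obtain ⟨z, hz1, hz2, hz3, hz4⟩ := inv m
  have h0 : s * 3 ^ 0 % n = s := by simp [Nat.mod_eq_of_lt hsn]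
  have hneg := aux_neg m n s 0 h (by omega)
  rw [zero_add, h0] at hneg
  obtain ⟨r, hr⟩ := hm
  omega

lemma aux_not (m w : ℕ) (hm : 0 < m) (hw : 1 ≤ w) (h : 3 ^ m + 1 = 4 * (54 * w + 7)) :
    9 * w ∉ cosetLeaders 3 (54 * w + 7) := by
  intro hs
  unfold cosetLeaders at hs
  rw [Finset.mem_filter, Finset.mem_range] at hs
  obtain ⟨hsn, -, hmin⟩ := hs
  have h1 := hmin _ (aux_mem_s19 _ (9 * w) (2 * m - 2) (aux_ord m _ hm h))
  have h2 : 9 * w * 3 ^ (2 * m - 2) % (54 * w + 7) = w % (54 * w + 7) := by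
    rw [← ZMod.natCast_eq_natCast_iff']
    have e : 9 * w * 3 ^ (2 * m - 2) = w * 3 ^ (2 * m) := by
      rw [show 2 * m = 2 * m - 2 + 2 by omega, pow_add]
      simp only [Nat.add_sub_cancel]
      ring
    rw [e, Nat.cast_mul, Nat.cast_pow, aux_pow m _ h, mul_one]
  rw [h2, Nat.mod_eq_of_lt (by omega)] at h1
  omega

lemma aux_sort (S : Finset ℕ) (a b : ℕ) (hab : b < a) (ha : a ∈ S) (hb : b ∈ S)
    (H : ∀ x ∈ S, x = a ∨ x ≤ b) :
    ∃ l : List ℕ, S.sort (· ≤ ·) = l ++ [b, a] := by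
  refine ⟨(S.filter (· < b)).sort (· ≤ ·), ?_⟩
  have e : ((S.filter (· < b)).sort (· ≤ ·) ++ [b, a]).toFinset = S := by
    ext x
    simp only [List.mem_toFinset, List.mem_append, Finset.mem_sort, Finset.mem_filter,
      List.mem_cons, List.not_mem_nil, or_false]
    constructor
    · rintro (h | h | h)
      · exact h.1
      · exact h ▸ hb
      · exact h ▸ ha
    · intro hx
      rcases H x hx with h | h
      · exact Or.inr (Or.inr h)
      · rcases h.lt_or_eq with h | h
        · exact Or.inl ⟨hx, h⟩
        · exact Or.inr (Or.inl h)
  have nd : ((S.filter (· < b)).sort (· ≤ ·) ++ [b, a]).Nodup := by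
    rw [List.nodup_append]
    refine ⟨Finset.sort_nodup _ _, by simp; omega, ?_⟩
    intro x hx y hy
    simp at hx hy
    omega
  conv_lhs => rw [← e]
  rw [List.toFinset_sort _ nd, List.pairwise_append]
  refine ⟨Finset.pairwise_sort _ _, by simp; omega, ?_⟩
  intro x hx y hy
  simp at hx hy
  omega

/-- for odd `m ≥ 5` and `n = (3^m+1)/4`, the first and second largest
coset leaders are `(3^{m-1}-1)/8` and `(3^{m-1}-1)/8 - 2`, each with coset size `2m`. -/
theorem stmt_19 (m n : ℕ) (hm : Odd m) (hm5 : 5 ≤ m) (hn : n = (3 ^ m + 1) / 4) :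
    nthLargestCosetLeader 3 n 1 = (3 ^ (m - 1) - 1) / 8 ∧
    nthLargestCosetLeader 3 n 2 = (3 ^ (m - 1) - 1) / 8 - 2 ∧
    (cycCoset 3 n ((3 ^ (m - 1) - 1) / 8)).card = 2 * m ∧
    (cycCoset 3 n ((3 ^ (m - 1) - 1) / 8 - 2)).card = 2 * m := by
  have h8 : 3 ^ (m - 3) % 8 = 1 := by
    obtain ⟨r, hr⟩ := hm
    rw [show m - 3 = 2 * (r - 1) by omega, pow_mul, Nat.pow_mod]
    norm_num
  obtain ⟨w, hw⟩ : ∃ w, 3 ^ (m - 3) = 8 * w + 1 := ⟨3 ^ (m - 3) / 8, by omega⟩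
  have hw1 : 1 ≤ w := by
    have : 3 ^ 2 ≤ 3 ^ (m - 3) := Nat.pow_le_pow_right (by norm_num) (by omega)
    omega
  have hp1 : 3 ^ (m - 1) = 72 * w + 9 := by
    rw [show m - 1 = m - 3 + 2 by omega, pow_add, hw]; ring
  have hpm : 3 ^ m = 216 * w + 27 := by
    rw [show m = m - 3 + 3 by omega, pow_add, hw]; ring
  obtain rfl : n = 54 * w + 7 := by omega
  have h : 3 ^ m + 1 = 4 * (54 * w + 7) := by omega
  have e1 : (3 ^ (m - 1) - 1) / 8 = 9 * w + 1 := by omega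
  rw [e1, show 9 * w + 1 - 2 = 9 * w - 1 by omega]
  obtain ⟨l1, c1⟩ := aux_leader_s19 m (54 * w + 7) (9 * w + 1) (by omega) h (by omega) (by omega)
    (aux_d1 m w hm5 hw1 hw)
  obtain ⟨l2, c2⟩ := aux_leader_s19 m (54 * w + 7) (9 * w - 1) (by omega) h (by omega) (by omega)
    (aux_d2 m w hm5 hw1 hw)
  obtain ⟨l, hl⟩ := aux_sort (cosetLeaders 3 (54 * w + 7)) (9 * w + 1) (9 * w - 1) (by omega) l1 l2
    (by
      intro x hx
      have h1 := aux_upper m w x hm h hx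
      have h2 : x ≠ 9 * w := by
        rintro rfl
        exact aux_not m w (by omega) hw1 h hx
      omega)
  refine ⟨?_, ?_, c1, c2⟩
  · unfold nthLargestCosetLeader
    rw [hl]; simp
  · unfold nthLargestCosetLeader
    rw [hl]; simp
end
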